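/- arXiv:1203.5352 — 4 statements merged into one kernel-verified Lean document; each statement's English description precedes it below -/
import Mathlib

section
/- Let k be a field with char(k) ≠ 2 and n ≥ 3. Suppose there exist a primitive n-th root of unity ω in an algebraic closure k̄ of k and α ∈ k whose image in k̄ equals (ω + ω⁻¹)/2; set β = α² − 1. Let q be a nondegenerate ternary quadratic form over k of discriminant 1 such that SO(q)(k) contains a subgroup isomorphic to the dihedral group of order 2n. Let D(⟨1,−β⟩) ≤ k^×/(k^×)² be the subgroup of square classes of nonzero elements x² − βy², and let C ≤ D(⟨1,−β⟩) be the subgroup generated by the square class of (α+1)/2. Then there is a bijection between the set of subgroups of SO(q)(k) isomorphic to the dihedral group of order 2n, modulo conjugation by elements of SO(q)(k), and the quotient group D(⟨1,−β⟩)/C. -/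
open Matrix

/-- The special orthogonal group `SO(q)(k)` of a ternary quadratic form with Gram matrix `Q`,
realized as the subgroup of `GL (Fin 3) k` consisting of the matrices `M` with
`Mᵀ * Q * M = Q` and `det M = 1`. -/
def SO3 (k : Type) [Field k] (Q : Matrix (Fin 3) (Fin 3) k) :
    Subgroup (GL (Fin 3) k) where
  carrier := {M | (M : Matrix (Fin 3) (Fin 3) k)ᵀ * Q * (M : Matrix (Fin 3) (Fin 3) k) = Q ∧
      (M : Matrix (Fin 3) (Fin 3) k).det = 1}
  one_mem' := by
    constructor
    · simp
    · simp
  mul_mem' := by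
    rintro A B ⟨hA, hA'⟩ ⟨hB, hB'⟩
    constructor
    · have hAB : ((A * B : GL (Fin 3) k) : Matrix (Fin 3) (Fin 3) k)
        = (A : Matrix (Fin 3) (Fin 3) k) * (B : Matrix (Fin 3) (Fin 3) k) := rfl
      rw [hAB, transpose_mul]
      calc (B : Matrix (Fin 3) (Fin 3) k)ᵀ * (A : Matrix (Fin 3) (Fin 3) k)ᵀ * Q *
            ((A : Matrix (Fin 3) (Fin 3) k) * (B : Matrix (Fin 3) (Fin 3) k))
          = (B : Matrix (Fin 3) (Fin 3) k)ᵀ *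
            ((A : Matrix (Fin 3) (Fin 3) k)ᵀ * Q * (A : Matrix (Fin 3) (Fin 3) k)) *
            (B : Matrix (Fin 3) (Fin 3) k) := by noncomm_ring
        _ = Q := by rw [hA, hB]
    · have hAB : ((A * B : GL (Fin 3) k) : Matrix (Fin 3) (Fin 3) k)
        = (A : Matrix (Fin 3) (Fin 3) k) * (B : Matrix (Fin 3) (Fin 3) k) := rfl
      rw [hAB, det_mul, hA', hB', one_mul]
  inv_mem' := by
    rintro A ⟨hA, hA'⟩
    have hinv : ((A⁻¹ : GL (Fin 3) k) : Matrix (Fin 3) (Fin 3) k)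
        = (A : Matrix (Fin 3) (Fin 3) k)⁻¹ := by
      simp [Matrix.coe_units_inv]
    have h1 : (A : Matrix (Fin 3) (Fin 3) k) * ((A⁻¹ : GL (Fin 3) k) : Matrix (Fin 3) (Fin 3) k)
        = 1 := by
      rw [hinv]
      exact Matrix.mul_nonsing_inv _ (by rw [hA']; exact isUnit_one)
    constructor
    · calc ((A⁻¹ : GL (Fin 3) k) : Matrix (Fin 3) (Fin 3) k)ᵀ * Q *
            ((A⁻¹ : GL (Fin 3) k) : Matrix (Fin 3) (Fin 3) k)
          = ((A⁻¹ : GL (Fin 3) k) : Matrix (Fin 3) (Fin 3) k)ᵀ *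
            ((A : Matrix (Fin 3) (Fin 3) k)ᵀ * Q * (A : Matrix (Fin 3) (Fin 3) k)) *
            ((A⁻¹ : GL (Fin 3) k) : Matrix (Fin 3) (Fin 3) k) := by rw [hA]
        _ = ((A : Matrix (Fin 3) (Fin 3) k) *
              ((A⁻¹ : GL (Fin 3) k) : Matrix (Fin 3) (Fin 3) k))ᵀ * Q *
            ((A : Matrix (Fin 3) (Fin 3) k) *
              ((A⁻¹ : GL (Fin 3) k) : Matrix (Fin 3) (Fin 3) k)) := by
            rw [transpose_mul]; noncomm_ring
        _ = Q := by rw [h1]; simp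
    · rw [hinv, Matrix.det_nonsing_inv, hA']; simp

/-- The group of square classes `k^× / (k^×)²`. -/
abbrev SqClasses (k : Type) [Field k] :=
  kˣ ⧸ (powMonoidHom 2 : kˣ →* kˣ).range

/-- The square class of a nonzero element of `k`. -/
def sqClass {k : Type} [Field k] (x : k) (hx : x ≠ 0) : SqClasses k :=
  QuotientGroup.mk (Units.mk0 x hx)

/-- Two subgroups `H₁, H₂` of `GL (Fin 3) k` are conjugate inside `SO(q)(k)`
if `P⁻¹ H₁ P = H₂` for some `P ∈ SO(q)(k)`. -/
def IsConjSubgroup (k : Type) [Field k] (Q : Matrix (Fin 3) (Fin 3) k)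
    (H₁ H₂ : Subgroup (GL (Fin 3) k)) : Prop :=
  ∃ P ∈ SO3 k Q, ∀ x : GL (Fin 3) k, x ∈ H₂ ↔ P * x * P⁻¹ ∈ H₁

/-- The set `D(⟨1,-β⟩)` of square classes of nonzero elements of the form `x² - βy²`. -/
def binRepClasses (k : Type) [Field k] (β : k) : Set (SqClasses k) :=
  {c | ∃ x y : k, ∃ h : x ^ 2 - β * y ^ 2 ≠ 0, c = sqClass (x ^ 2 - β * y ^ 2) h}

/-- The subgroup `C` of `k^×/(k^×)²` generated by the square class of `(α+1)/2`. -/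
def alphaClassSubgroup (k : Type) [Field k] (α : k) : Subgroup (SqClasses k) :=
  Subgroup.closure {c | ∃ h : (α + 1) / 2 ≠ 0, c = sqClass ((α + 1) / 2) h}

section

variable {k : Type} [Field k]

open Polynomial in
theorem charpoly_fin_three_eq (A : Matrix (Fin 3) (Fin 3) k) :
    A.charpoly = X ^ 3 - C A.trace * X ^ 2 + C A.adjugate.trace * X - C A.det := by
  rw [Matrix.charpoly, det_fin_three, det_fin_three, trace_fin_three, trace_fin_three,
    adjugate_fin_three]
  simp
  ring

namespace SO3

variable {Q : Matrix (Fin 3) (Fin 3) k} {s : GL (Fin 3) k}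

theorem trace_adjugate (hQ : IsUnit Q.det) (hs : s ∈ SO3 k Q) :
    (s : Matrix (Fin 3) (Fin 3) k).adjugate.trace = (s : Matrix (Fin 3) (Fin 3) k).trace := by
  obtain ⟨h1, h2⟩ := hs
  set M := (s : Matrix (Fin 3) (Fin 3) k)
  have h3 : M.adjugate = Q⁻¹ * Mᵀ * Q := by
    calc M.adjugate = Q⁻¹ * Q * M.adjugate := by rw [nonsing_inv_mul _ hQ, one_mul]
      _ = Q⁻¹ * (Mᵀ * Q * M) * M.adjugate := by rw [h1]
      _ = Q⁻¹ * Mᵀ * Q * (M * M.adjugate) := by simp only [Matrix.mul_assoc]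
      _ = _ := by rw [mul_adjugate, h2]; simp
  rw [h3, mul_assoc, trace_mul_comm, mul_assoc, mul_nonsing_inv _ hQ, mul_one, trace_transpose]

open Polynomial in
theorem charpoly_eq (hQ : IsUnit Q.det) (hs : s ∈ SO3 k Q) :
    (s : Matrix (Fin 3) (Fin 3) k).charpoly =
      (X - 1) * (X ^ 2 - C ((s : Matrix (Fin 3) (Fin 3) k).trace - 1) * X + 1) := by
  rw [charpoly_fin_three_eq, trace_adjugate hQ hs, hs.2]
  simp
  ring

theorem exists_fixed (hQ : IsUnit Q.det) (hs : s ∈ SO3 k Q) :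
    ∃ v, v ≠ 0 ∧ (s : Matrix (Fin 3) (Fin 3) k) *ᵥ v = v := by
  have h := congrArg (Polynomial.eval 1) (charpoly_eq hQ hs)
  rw [Matrix.eval_charpoly] at h
  simp only [map_one, Polynomial.eval_mul, Polynomial.eval_sub, Polynomial.eval_X,
    Polynomial.eval_one, sub_self, zero_mul] at h
  obtain ⟨v, hv0, hv⟩ := Matrix.exists_mulVec_eq_zero_iff.2 h
  exact ⟨v, hv0, by rw [sub_mulVec, one_mulVec, sub_eq_zero] at hv; exact hv.symm⟩

open Polynomial in
/-- An element of `SO3 k Q` of order `n` has a power, generating the same subgroup, with the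
eigenvalue `ω`. -/
theorem exists_pow_trace_eq {K : Type} [Field K] [IsAlgClosed K] [Algebra k K]
    (hQ : IsUnit Q.det) (hs : s ∈ SO3 k Q) {n : ℕ} [NeZero n] (hn : orderOf s = n)
    {ω : K} (hω : IsPrimitiveRoot ω n) (hω1 : ω ≠ 1) :
    ∃ j : ℕ, j.Coprime n ∧
      algebraMap k K ((s ^ j : GL (Fin 3) k) : Matrix (Fin 3) (Fin 3) k).trace = 1 + ω + ω⁻¹ := by
  have hnK : (n : K) ≠ 0 := hω.neZero'.out
  let φ : Matrix (Fin 3) (Fin 3) k →+* Matrix (Fin 3) (Fin 3) K := (algebraMap k K).mapMatrix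
  have hφ : Function.Injective φ := Matrix.map_injective (algebraMap k K).injective
  have hchar : ∀ t ∈ SO3 k Q, (φ (t : Matrix (Fin 3) (Fin 3) k)).charpoly =
      (X - 1) * (X ^ 2 - C (algebraMap k K ((t : Matrix (Fin 3) (Fin 3) k).trace) - 1) * X +
        1) := by
    intro t ht
    have := congrArg (Polynomial.map (algebraMap k K)) (charpoly_eq hQ ht)
    rw [← Matrix.charpoly_map] at this
    simpa [φ] using this
  set M := φ (s : Matrix (Fin 3) (Fin 3) k) with hM
  have hMpow : ∀ l : ℕ, M ^ l = 1 ↔ n ∣ l := by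
    intro l
    rw [← hn, orderOf_dvd_iff_pow_eq_one, hM, ← map_pow, ← map_one φ, hφ.eq_iff,
      ← Units.val_pow_eq_pow_val]
    exact Units.val_eq_one
  set τ := algebraMap k K ((s : Matrix (Fin 3) (Fin 3) k).trace) with hτ
  obtain ⟨ζ, hζ⟩ : ∃ ζ : K, ζ ^ 2 - (τ - 1) * ζ + 1 = 0 := by
    have hd : (X ^ 2 - C (τ - 1) * X + 1 : K[X]).degree = 2 := by compute_degree!
    obtain ⟨ζ, hζ⟩ := IsAlgClosed.exists_root (X ^ 2 - C (τ - 1) * X + 1 : K[X])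
      (by rw [hd]; decide)
    exact ⟨ζ, by simpa [IsRoot] using hζ⟩
  have hζ0 : ζ ≠ 0 := by rintro rfl; simp at hζ
  have hMc := hchar s hs
  have hτζ : τ - 1 = ζ + ζ⁻¹ := by field_simp; linear_combination -hζ
  have hfac : M.charpoly = (X - 1) * ((X - C ζ) * (X - C ζ⁻¹)) := by
    have : (C ζ * C ζ⁻¹ : K[X]) = 1 := by rw [← C_mul, mul_inv_cancel₀ hζ0, C_1]
    rw [hMc, ← hτ, hτζ, C_add]
    linear_combination -(X - 1) * this
  have hspec : ζ ∈ spectrum K M := by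
    rw [Matrix.mem_spectrum_iff_isRoot_charpoly, hfac]
    simp [IsRoot]
  have hminn : minpoly K M ∣ X ^ n - 1 := minpoly.dvd _ _ (by simp [(hMpow n).2 dvd_rfl])
  have hsq : Squarefree (minpoly K M) :=
    ((X_pow_sub_one_separable_iff.2 hnK).squarefree).squarefree_of_dvd hminn
  have hprim : IsPrimitiveRoot ζ n := by
    constructor
    · have h := spectrum.pow_mem_pow M n hspec
      rw [(hMpow n).2 dvd_rfl, spectrum.one_eq] at h
      exact h
    · intro l hl
      rw [← hMpow l]
      have hr : ∀ z : K, z ^ l = 1 → X - C z ∣ (X ^ l - 1 : K[X]) := fun z hz => by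
        rw [dvd_iff_isRoot]; simp [hz]
      have h3 : M.charpoly ∣ (X ^ l - 1) ^ 3 := by
        rw [hfac, pow_succ', pow_two]
        exact mul_dvd_mul (by simpa using hr 1 (one_pow l))
          (mul_dvd_mul (hr _ hl) (hr _ (by rw [inv_pow, hl, inv_one])))
      have h1 := (hsq.dvd_pow_iff_dvd three_ne_zero).1 ((Matrix.minpoly_dvd_charpoly M).trans h3)
      obtain ⟨p, hp⟩ := h1
      have h4 := congrArg (aeval M) hp
      rw [map_mul, minpoly.aeval, zero_mul] at h4
      simpa [sub_eq_zero] using h4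
  obtain ⟨j, -, hj, hjω⟩ := hprim.isPrimitiveRoot_iff.1 hω
  refine ⟨j, hj, ?_⟩
  have h := spectrum.pow_mem_pow M j hspec
  have hsj : s ^ j ∈ SO3 k Q := Subgroup.pow_mem _ hs j
  rw [hjω, hM, ← map_pow, ← Units.val_pow_eq_pow_val, Matrix.mem_spectrum_iff_isRoot_charpoly,
    hchar _ hsj] at h
  simp only [IsRoot, eval_mul, eval_sub, eval_X, eval_one, eval_add, eval_pow, eval_C,
    mul_eq_zero, sub_eq_zero, hω1, false_or] at h
  have hω0 : ω ≠ 0 := hω.ne_zero (NeZero.ne n)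
  field_simp
  linear_combination -h

end SO3
end

section

variable {k : Type} [Field k]

/-- The rotation with cosine `α` in the first two coordinates, preserving `⟨1, 1 - α²⟩`. -/
def stdRot (α : k) : GL (Fin 3) k where
  val := !![α, α ^ 2 - 1, 0; 1, α, 0; 0, 0, 1]
  inv := !![α, -(α ^ 2 - 1), 0; -1, α, 0; 0, 0, 1]
  val_inv := by
    ext i j; fin_cases i <;> fin_cases j <;> simp [Matrix.mul_apply, Fin.sum_univ_three] <;> ring
  inv_val := by
    ext i j; fin_cases i <;> fin_cases j <;> simp [Matrix.mul_apply, Fin.sum_univ_three] <;> ring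

/-- The involution `diag(1, -1, -1)`. -/
def stdFlip (k : Type) [Field k] : GL (Fin 3) k where
  val := !![1, 0, 0; 0, -1, 0; 0, 0, -1]
  inv := !![1, 0, 0; 0, -1, 0; 0, 0, -1]
  val_inv := by
    ext i j; fin_cases i <;> fin_cases j <;> simp [Matrix.mul_apply, Fin.sum_univ_three]
  inv_val := by
    ext i j; fin_cases i <;> fin_cases j <;> simp [Matrix.mul_apply, Fin.sum_univ_three]

/-- The diagonal form `⟨a, -βa, -β⟩` with `β = α² - 1`. -/
def stdForm (α a : k) : Matrix (Fin 3) (Fin 3) k :=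
  !![a, 0, 0; 0, -(α ^ 2 - 1) * a, 0; 0, 0, -(α ^ 2 - 1)]

/-- The subgroup generated by `stdRot α` and `stdFlip k`. -/
def stdDihedral (α : k) : Subgroup (GL (Fin 3) k) :=
  Subgroup.closure {stdRot α, stdFlip k}

/-- Multiplication by `x + y√β` in the first two coordinates, where `β = α² - 1`. -/
noncomputable def stdScale (α x y : k) (h : x ^ 2 - (α ^ 2 - 1) * y ^ 2 ≠ 0) : GL (Fin 3) k :=
  GeneralLinearGroup.mkOfDetNeZero !![x, (α ^ 2 - 1) * y, 0; y, x, 0; 0, 0, 1] (by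
    rw [det_fin_three]; simpa [pow_two, mul_assoc, mul_comm, mul_left_comm] using h)

/-- `E` is a basis in which `q` has Gram matrix `stdForm α a` and `H` is the standard dihedral
group. -/
structure IsFrame (Q : Matrix (Fin 3) (Fin 3) k) (α : k) (H : Subgroup (GL (Fin 3) k)) (a : k)
    (E : GL (Fin 3) k) : Prop where
  ne_zero : a ≠ 0
  gram : (E : Matrix (Fin 3) (Fin 3) k)ᵀ * Q * (E : Matrix (Fin 3) (Fin 3) k) = stdForm α a
  eq_map : H = (stdDihedral α).map (MulAut.conj E).toMonoidHom

theorem stdFlip_mul_self : stdFlip k * stdFlip k = 1 := Units.ext (stdFlip k).val_inv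

theorem val_inv_stdRot (α : k) : ((stdRot α)⁻¹ : GL (Fin 3) k).val =
    !![α, -(α ^ 2 - 1), 0; -1, α, 0; 0, 0, 1] := rfl

theorem stdFlip_conj (α : k) : stdFlip k * stdRot α * stdFlip k = (stdRot α)⁻¹ := by
  ext i j
  rw [val_inv_stdRot]
  fin_cases i <;> fin_cases j <;>
    simp [stdFlip, stdRot, Matrix.mul_apply, Fin.sum_univ_three]

theorem stdFlip_mul_zpow (α : k) (i : ℤ) :
    stdFlip k * stdRot α ^ i = stdRot α ^ (-i) * stdFlip k := by
  have hT : (stdFlip k)⁻¹ = stdFlip k := rfl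
  have h := conj_zpow (i := i) (a := stdFlip k) (b := stdRot α)
  rw [hT, stdFlip_conj, _root_.inv_zpow', eq_comm] at h
  rw [← h, mul_assoc _ (stdFlip k), stdFlip_mul_self, mul_one]

theorem stdRot_gram (α a : k) :
    (stdRot α).valᵀ * stdForm α a * (stdRot α).val = stdForm α a := by
  ext i j
  fin_cases i <;> fin_cases j <;>
    simp [stdForm, stdRot, Matrix.mul_apply, Fin.sum_univ_three] <;> ring

theorem stdRot_mem_SO3 (α a : k) : stdRot α ∈ SO3 k (stdForm α a) :=
  ⟨stdRot_gram α a, by rw [det_fin_three]; simp [stdRot]; ring⟩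

theorem stdScale_commute (α x y : k) (h : x ^ 2 - (α ^ 2 - 1) * y ^ 2 ≠ 0) :
    Commute (stdScale α x y h) (stdRot α) := by
  ext i j
  fin_cases i <;> fin_cases j <;>
    simp [stdScale, GeneralLinearGroup.mkOfDetNeZero, stdRot, Matrix.mul_apply,
      Fin.sum_univ_three] <;> ring

theorem stdScale_gram (α a x y : k) (h : x ^ 2 - (α ^ 2 - 1) * y ^ 2 ≠ 0) :
    (stdScale α x y h : Matrix (Fin 3) (Fin 3) k)ᵀ * stdForm α a *
      (stdScale α x y h : Matrix (Fin 3) (Fin 3) k) =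
      stdForm α (a * (x ^ 2 - (α ^ 2 - 1) * y ^ 2)) := by
  ext i j
  fin_cases i <;> fin_cases j <;>
    simp [stdScale, GeneralLinearGroup.mkOfDetNeZero, stdForm, Matrix.mul_apply,
      Fin.sum_univ_three] <;> ring

theorem stdScale_flip (α x : k) (h : x ^ 2 - (α ^ 2 - 1) * 0 ^ 2 ≠ 0) :
    Commute (stdScale α x 0 h) (stdFlip k) := by
  ext i j
  fin_cases i <;> fin_cases j <;>
    simp [stdScale, GeneralLinearGroup.mkOfDetNeZero, stdFlip, Matrix.mul_apply, Fin.sum_univ_three]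

theorem stdScale_bisect (α : k) (h : (1 + α) ^ 2 - (α ^ 2 - 1) * 1 ^ 2 ≠ 0) :
    stdScale α (1 + α) 1 h * stdFlip k = stdRot α * stdFlip k * stdScale α (1 + α) 1 h := by
  ext i j
  fin_cases i <;> fin_cases j <;>
    simp [stdScale, GeneralLinearGroup.mkOfDetNeZero, stdFlip, stdRot, Matrix.mul_apply,
      Fin.sum_univ_three] <;> ring

theorem map_conj_mul (α : k) (E F : GL (Fin 3) k) :
    (stdDihedral α).map (MulAut.conj (E * F)).toMonoidHom =
      ((stdDihedral α).map (MulAut.conj F).toMonoidHom).map (MulAut.conj E).toMonoidHom := by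
  rw [Subgroup.map_map]
  congr 1
  ext1 x
  simp

theorem map_conj_stdScale (α x : k) (h : x ^ 2 - (α ^ 2 - 1) * 0 ^ 2 ≠ 0) :
    (stdDihedral α).map (MulAut.conj (stdScale α x 0 h)).toMonoidHom = stdDihedral α := by
  rw [stdDihedral, MonoidHom.map_closure, Set.image_pair]
  simp [(stdScale_commute α x 0 h).eq, (stdScale_flip α x h).eq]

theorem map_conj_stdScale_bisect (α : k) (h : (1 + α) ^ 2 - (α ^ 2 - 1) * 1 ^ 2 ≠ 0) :
    (stdDihedral α).map (MulAut.conj (stdScale α (1 + α) 1 h)).toMonoidHom = stdDihedral α := by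
  rw [stdDihedral, MonoidHom.map_closure, Set.image_pair]
  simp only [MulEquiv.coe_toMonoidHom, MulAut.conj_apply, (stdScale_commute α (1 + α) 1 h).eq,
    stdScale_bisect, mul_inv_cancel_right]
  apply le_antisymm <;> rw [Subgroup.closure_le, Set.insert_subset_iff, Set.singleton_subset_iff]
  · exact ⟨Subgroup.subset_closure (by simp),
      mul_mem (Subgroup.subset_closure (by simp)) (Subgroup.subset_closure (by simp))⟩
  · have h1 : stdRot α ∈ Subgroup.closure {stdRot α, stdRot α * stdFlip k} :=
      Subgroup.subset_closure (by simp)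
    have h2 : stdRot α * stdFlip k ∈ Subgroup.closure {stdRot α, stdRot α * stdFlip k} :=
      Subgroup.subset_closure (by simp)
    exact ⟨h1, by simpa using mul_mem (inv_mem h1) h2⟩

namespace IsFrame

variable {Q : Matrix (Fin 3) (Fin 3) k} {α a b : k} {H H' : Subgroup (GL (Fin 3) k)}
  {E F : GL (Fin 3) k}

theorem mul_stdScale (hE : IsFrame Q α H a E) (x y : k) (h : x ^ 2 - (α ^ 2 - 1) * y ^ 2 ≠ 0) :
    IsFrame Q α ((stdDihedral α).map (MulAut.conj (E * stdScale α x y h)).toMonoidHom)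
      (a * (x ^ 2 - (α ^ 2 - 1) * y ^ 2)) (E * stdScale α x y h) where
  ne_zero := mul_ne_zero hE.ne_zero h
  gram := by
    rw [← stdScale_gram _ _ _ _ h, ← hE.gram]
    simp [transpose_mul, Matrix.mul_assoc]
  eq_map := rfl

theorem smul_sq (hE : IsFrame Q α H a E) {c : k} (hc : c ≠ 0) :
    ∃ E', IsFrame Q α H (c ^ 2 * a) E' := by
  have h : c ^ 2 - (α ^ 2 - 1) * 0 ^ 2 ≠ 0 := by simpa
  refine ⟨E * stdScale α c 0 h, ?_⟩
  have := hE.mul_stdScale c 0 h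
  rw [map_conj_mul, map_conj_stdScale, ← hE.eq_map] at this
  convert this using 1
  ring

theorem bisect (hE : IsFrame Q α H a E) (h2 : (2 : k) ≠ 0) (hα : α + 1 ≠ 0) :
    ∃ E', IsFrame Q α H (a * ((α + 1) / 2)) E' := by
  have h : (1 + α) ^ 2 - (α ^ 2 - 1) * 1 ^ 2 ≠ 0 := by
    have : (1 + α) ^ 2 - (α ^ 2 - 1) * 1 ^ 2 = 2 * (α + 1) := by ring
    rw [this]; exact mul_ne_zero h2 hα
  have h1 := hE.mul_stdScale (1 + α) 1 h
  rw [map_conj_mul, map_conj_stdScale_bisect, ← hE.eq_map] at h1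
  obtain ⟨E', h3⟩ := h1.smul_sq (inv_ne_zero h2)
  refine ⟨E', ?_⟩
  convert h3 using 1
  field_simp
  ring

theorem gram_mul_inv (hE : IsFrame Q α H a E) (hF : IsFrame Q α H' a F) :
    ((E * F⁻¹ : GL (Fin 3) k) : Matrix (Fin 3) (Fin 3) k)ᵀ * Q *
      ((E * F⁻¹ : GL (Fin 3) k) : Matrix (Fin 3) (Fin 3) k) = Q := by
  have h1 : (F : Matrix (Fin 3) (Fin 3) k) * (F⁻¹ : GL (Fin 3) k).val = 1 := F.mul_inv
  have h2 := congrArg transpose h1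
  rw [transpose_mul, transpose_one] at h2
  calc _ = (F⁻¹ : GL (Fin 3) k).valᵀ * (E.valᵀ * Q * E.val) * (F⁻¹ : GL (Fin 3) k).val := by
        rw [Units.val_mul, transpose_mul]; simp only [Matrix.mul_assoc]
    _ = (F⁻¹ : GL (Fin 3) k).valᵀ * (F.valᵀ * Q * F.val) * (F⁻¹ : GL (Fin 3) k).val := by
        rw [hE.gram, hF.gram]
    _ = ((F⁻¹ : GL (Fin 3) k).valᵀ * F.valᵀ) * Q * (F.val * (F⁻¹ : GL (Fin 3) k).val) := by
        simp only [Matrix.mul_assoc]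
    _ = Q := by rw [h1, h2, one_mul, mul_one]

theorem isConjSubgroup (hQ : Q.det ≠ 0) (hE : IsFrame Q α H a E) (hF : IsFrame Q α H' a F) :
    IsConjSubgroup k Q H H' := by
  have hg := hE.gram_mul_inv hF
  set P : GL (Fin 3) k := E * F⁻¹ with hP
  have hmem : ∀ x, x ∈ H' ↔ P * x * P⁻¹ ∈ H := by
    intro x
    rw [hE.eq_map, hF.eq_map, Subgroup.mem_map_equiv, Subgroup.mem_map_equiv]
    simp [MulAut.conj_symm_apply, hP, mul_assoc]
  have hdet : P.val.det * P.val.det = 1 := by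
    have := congrArg det hg
    rw [det_mul, det_mul, det_transpose] at this
    apply mul_right_cancel₀ hQ
    linear_combination this
  rcases mul_self_eq_one_iff.1 hdet with h | h
  · exact ⟨P, ⟨hg, h⟩, hmem⟩
  · refine ⟨-P, ⟨by simpa using hg, ?_⟩, fun x => by simpa using hmem x⟩
    rw [Units.val_neg, det_neg, h]; norm_num

theorem le (hE : IsFrame Q α H a E) : H ≤ SO3 k Q := by
  have key : ∀ x : GL (Fin 3) k, x.valᵀ * stdForm α a * x.val = stdForm α a → x.val.det = 1 →
      E * x * E⁻¹ ∈ SO3 k Q := by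
    intro x hx hd
    constructor
    · have h1 : (E : Matrix (Fin 3) (Fin 3) k) * (E⁻¹ : GL (Fin 3) k).val = 1 := E.mul_inv
      have h2 := congrArg transpose h1
      rw [transpose_mul, transpose_one] at h2
      calc _ = (E⁻¹ : GL (Fin 3) k).valᵀ * (x.valᵀ * (E.valᵀ * Q * E.val) * x.val) *
              (E⁻¹ : GL (Fin 3) k).val := by
            simp only [Units.val_mul, transpose_mul, Matrix.mul_assoc]
        _ = ((E⁻¹ : GL (Fin 3) k).valᵀ * E.valᵀ) * Q * (E.val * (E⁻¹ : GL (Fin 3) k).val) := by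
            rw [hE.gram, hx, ← hE.gram]; simp only [Matrix.mul_assoc]
        _ = Q := by rw [h1, h2, one_mul, mul_one]
    · rw [Units.val_mul, Units.val_mul, det_mul_right_comm, ← Units.val_mul, mul_inv_cancel]
      simpa using hd
  rw [hE.eq_map, stdDihedral, MonoidHom.map_closure, Subgroup.closure_le, Set.image_pair,
    Set.insert_subset_iff, Set.singleton_subset_iff]
  constructor
  · exact key _ (stdRot_gram α a) (stdRot_mem_SO3 α a).2
  · refine key _ ?_ ?_
    · ext i j
      fin_cases i <;> fin_cases j <;>
        simp [stdForm, stdFlip, Matrix.mul_apply, Fin.sum_univ_three]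
    · rw [det_fin_three]; simp [stdFlip]

theorem nonempty_mulEquiv (hE : IsFrame Q α H a E) : Nonempty (H ≃* stdDihedral α) := by
  rw [hE.eq_map]
  exact ⟨((MulAut.conj E).subgroupMap (stdDihedral α)).symm⟩

theorem transport {P : GL (Fin 3) k} (hP : P ∈ SO3 k Q) (hE : IsFrame Q α H a E)
    (h : ∀ x, x ∈ H ↔ P * x * P⁻¹ ∈ H') : IsFrame Q α H' a (P * E) where
  ne_zero := hE.ne_zero
  gram := by
    rw [← hE.gram, Units.val_mul, transpose_mul]
    conv_rhs => rw [← hP.1]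
    simp only [Matrix.mul_assoc]
  eq_map := by
    rw [map_conj_mul, ← hE.eq_map]
    ext x
    rw [Subgroup.mem_map_equiv, h]
    simp [MulAut.conj_symm_apply, mul_assoc]

theorem exists_change (hE : IsFrame Q α H a E) (hF : IsFrame Q α H' b F) :
    (E⁻¹ * F).valᵀ * stdForm α a * (E⁻¹ * F).val = stdForm α b := by
  rw [← hE.gram, ← hF.gram]
  have h1 : (E : Matrix (Fin 3) (Fin 3) k) * (E⁻¹ : GL (Fin 3) k).val = 1 := E.mul_inv
  have h2 : (E⁻¹ : GL (Fin 3) k).valᵀ * E.valᵀ = 1 := by rw [← transpose_mul, h1, transpose_one]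
  calc _ = F.valᵀ * ((E⁻¹ : GL (Fin 3) k).valᵀ * E.valᵀ) * Q *
        (E.val * (E⁻¹ : GL (Fin 3) k).val) * F.val := by
        simp only [Units.val_mul, transpose_mul, Matrix.mul_assoc]
    _ = _ := by rw [h1, h2, mul_one, mul_one]

/-- Witt cancellation of the third coordinate. -/
theorem exists_norm (h2 : (2 : k) ≠ 0) (hE : IsFrame Q α H a E)
    (hF : IsFrame Q α H' b F) :
    ∃ x y : k, b = a * (x ^ 2 - (α ^ 2 - 1) * y ^ 2) := by
  have hG := hE.exists_change hF
  generalize E⁻¹ * F = G at hG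
  have h00 := congrFun (congrFun hG 0) 0
  have h22 := congrFun (congrFun hG 2) 2
  have h02 := congrFun (congrFun hG 0) 2
  simp [stdForm, Matrix.mul_apply, Fin.sum_univ_three] at h00 h22 h02
  generalize G.val 0 0 = p at *
  generalize G.val 1 0 = q at *
  generalize G.val 2 0 = r at *
  generalize G.val 0 2 = l at *
  generalize G.val 1 2 = m at *
  generalize G.val 2 2 = t at *
  obtain ⟨ε, hε, hεt⟩ : ∃ ε : k, ε ^ 2 = 1 ∧ 1 - ε * t ≠ 0 := by
    by_cases ht : t = 1
    · exact ⟨-1, by ring, by rw [ht]; norm_num; exact h2⟩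
    · exact ⟨1, by ring, by rw [one_mul, sub_ne_zero]; exact Ne.symm ht⟩
  refine ⟨p + ε * r * l / (1 - ε * t), q + ε * r * m / (1 - ε * t), ?_⟩
  field_simp
  linear_combination -(1 - ε * t) ^ 2 * h00 - 2 * (1 - ε * t) * ε * r * h02 -
    r ^ 2 * ε ^ 2 * h22 + (α ^ 2 - 1) * r ^ 2 * hε

end IsFrame
theorem mem_stdDihedral {α : k} {x : GL (Fin 3) k} (hx : x ∈ stdDihedral α) :
    ∃ i : ℤ, x = stdRot α ^ i ∨ x = stdRot α ^ i * stdFlip k := by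
  induction hx using Subgroup.closure_induction with
  | mem x hx =>
    rcases hx with rfl | rfl
    · exact ⟨1, Or.inl (by simp)⟩
    · exact ⟨0, Or.inr (by simp)⟩
  | one => exact ⟨0, Or.inl (by simp)⟩
  | mul x y _ _ hx hy =>
    obtain ⟨i, rfl | rfl⟩ := hx <;> obtain ⟨j, rfl | rfl⟩ := hy
    · exact ⟨i + j, Or.inl (_root_.zpow_add _ _ _).symm⟩
    · exact ⟨i + j, Or.inr (by rw [_root_.zpow_add, mul_assoc])⟩
    · exact ⟨i + -j, Or.inr (by rw [mul_assoc, stdFlip_mul_zpow, _root_.zpow_add, mul_assoc])⟩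
    · exact ⟨i + -j, Or.inl (by
        rw [mul_assoc, ← mul_assoc (stdFlip k), stdFlip_mul_zpow, _root_.zpow_add,
          mul_assoc _ (stdFlip k),
          stdFlip_mul_self, mul_one])⟩
  | inv x _ hx =>
    obtain ⟨i, rfl | rfl⟩ := hx
    · exact ⟨-i, Or.inl (_root_.zpow_neg _ _).symm⟩
    · exact ⟨i, Or.inr (by 
        rw [_root_.mul_inv_rev, ← _root_.zpow_neg]
        exact (stdFlip_mul_zpow α (-i)).trans (by rw [neg_neg]))⟩

theorem stdRot_mul_self_ne_one (h2 : (2 : k) ≠ 0) {α : k} (hα : α ^ 2 - 1 ≠ 0) :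
    stdRot α * stdRot α ≠ 1 := by
  intro h
  have := congrArg (fun x : GL (Fin 3) k => x.val 0 0) h
  simp [stdRot, Matrix.mul_apply, Fin.sum_univ_three] at this
  have h3 : 2 * (α ^ 2 - 1) = 0 := by linear_combination this
  exact mul_ne_zero h2 hα h3

theorem stdRot_zpow_gram (α a : k) (i : ℤ) :
    (stdRot α ^ i).valᵀ * stdForm α a * (stdRot α ^ i).val = stdForm α a :=
  (Subgroup.zpow_mem _ (stdRot_mem_SO3 α a) i).1

namespace IsFrame

variable {Q : Matrix (Fin 3) (Fin 3) k} {α a b : k} {H H' : Subgroup (GL (Fin 3) k)}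
  {E F : GL (Fin 3) k}

theorem eq_sq_mul (h2 : (2 : k) ≠ 0) (hα : α ^ 2 - 1 ≠ 0) (hE : IsFrame Q α H a E)
    (hF : IsFrame Q α H b F) :
    ∃ c : k, c ≠ 0 ∧ (b = c ^ 2 * a ∨ b = c ^ 2 * (a * ((α + 1) / 2))) := by
  suffices ∃ c : k, b = c ^ 2 * a ∨ b = c ^ 2 * (a * ((α + 1) / 2)) by
    obtain ⟨c, hc⟩ := this
    refine ⟨c, ?_, hc⟩
    rintro rfl
    exact hF.ne_zero (by simpa using hc)
  have hG := hE.exists_change hF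
  have hmap : ∀ x ∈ stdDihedral α, (E⁻¹ * F) * x * (E⁻¹ * F)⁻¹ ∈ stdDihedral α := by
    intro x hx
    have h1 : F * x * F⁻¹ ∈ H := by
      rw [hF.eq_map]; exact ⟨x, hx, by simp⟩
    rw [hE.eq_map, Subgroup.mem_map_equiv] at h1
    simpa [MulAut.conj_symm_apply, mul_assoc] using h1
  generalize E⁻¹ * F = G at hG hmap
  obtain ⟨i, hi⟩ := mem_stdDihedral (hmap _ (Subgroup.subset_closure (by simp) : stdFlip k ∈ _))
  have hne : ∀ i j : ℤ, G * stdFlip k * G⁻¹ = stdRot α ^ i → G * stdRot α * G⁻¹ ≠ stdRot α ^ j := by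
    intro i j hi hj
    have h1 : Commute (G * stdFlip k * G⁻¹) (G * stdRot α * G⁻¹) := by
      rw [hi, hj]; exact Commute.zpow_zpow_self _ _ _
    have h3 : Commute (stdFlip k) (stdRot α) := by
      have := h1.eq
      simp only [mul_assoc, inv_mul_cancel_left, mul_right_inj] at this
      simp only [← mul_assoc, mul_left_inj] at this
      exact this
    have h4 := stdFlip_conj α
    rw [h3.eq, mul_assoc, stdFlip_mul_self, mul_one] at h4
    exact stdRot_mul_self_ne_one h2 hα (mul_eq_one_iff_eq_inv.2 h4)
  have hi' : ∃ i : ℤ, G * stdFlip k * G⁻¹ = stdRot α ^ i * stdFlip k := by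
    rcases hi with hi | hi
    swap
    · exact ⟨i, hi⟩
    exfalso
    obtain ⟨j, hj | hj⟩ := mem_stdDihedral
      (hmap _ (Subgroup.subset_closure (by simp) : stdRot α ∈ _))
    · exact hne i j hi hj
    · apply stdRot_mul_self_ne_one h2 hα
      have h5 : (G * stdRot α * G⁻¹) * (G * stdRot α * G⁻¹) = 1 := by
        rw [hj]
        rw [mul_assoc, ← mul_assoc (stdFlip k), stdFlip_mul_zpow, mul_assoc _ (stdFlip k),
          stdFlip_mul_self]
        simp
      have h6 : G * (stdRot α * stdRot α) * G⁻¹ = 1 := by simpa [mul_assoc] using h5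
      simpa using h6
  clear hi i
  obtain ⟨i, hi⟩ := hi'
  obtain ⟨j, hj⟩ := Int.even_or_odd' i
  have hG' : (stdRot α ^ (-j) * G).valᵀ * stdForm α a * (stdRot α ^ (-j) * G).val =
      stdForm α b := by
    rw [← hG, Units.val_mul, transpose_mul]
    conv_rhs => rw [← stdRot_zpow_gram α a (-j)]
    simp only [Matrix.mul_assoc]
  have hi2 : G * stdFlip k = stdRot α ^ i * stdFlip k * G := by rw [← hi]; group
  have h00 := congrFun (congrFun hG' 0) 0
  rcases hj with rfl | rfl
  · have h7 : stdFlip k * (stdRot α ^ (-j) * G) = stdRot α ^ (-j) * G * stdFlip k := by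
      rw [← mul_assoc, stdFlip_mul_zpow, mul_assoc (_ ^ _) G, hi2, ← mul_assoc, ← mul_assoc,
        ← _root_.zpow_add]
      congr 3
      ring
    generalize stdRot α ^ (-j) * G = G' at *
    have e1 := congrArg (fun x : GL (Fin 3) k => x.val 1 0) h7
    have e2 := congrArg (fun x : GL (Fin 3) k => x.val 2 0) h7
    simp [stdFlip, stdForm, Matrix.mul_apply, Fin.sum_univ_three] at e1 e2 h00
    refine ⟨G'.val 0 0, Or.inl ?_⟩
    have e1' : G'.val 1 0 = 0 := by
      apply (mul_eq_zero.1 (_ : 2 * G'.val 1 0 = 0)).resolve_left h2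
      linear_combination -e1
    have e2' : G'.val 2 0 = 0 := by
      apply (mul_eq_zero.1 (_ : 2 * G'.val 2 0 = 0)).resolve_left h2
      linear_combination -e2
    rw [e1', e2'] at h00
    linear_combination -h00
  · have h7 : stdRot α * stdFlip k * (stdRot α ^ (-j) * G) = stdRot α ^ (-j) * G * stdFlip k := by
      rw [← mul_assoc, mul_assoc (stdRot α), stdFlip_mul_zpow, mul_assoc (_ ^ _) G, hi2,
        ← mul_assoc,
        ← mul_assoc, ← mul_assoc, ← _root_.zpow_one_add, ← _root_.zpow_add]
      congr 3
      ring
    generalize stdRot α ^ (-j) * G = G' at *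
    have e1 := congrArg (fun x : GL (Fin 3) k => x.val 1 0) h7
    have e2 := congrArg (fun x : GL (Fin 3) k => x.val 2 0) h7
    simp [stdFlip, stdRot, stdForm, Matrix.mul_apply, Fin.sum_univ_three] at e1 e2 h00
    refine ⟨2 * G'.val 1 0, Or.inr ?_⟩
    have e1' : G'.val 0 0 = (1 + α) * G'.val 1 0 := by linear_combination e1
    have e2' : G'.val 2 0 = 0 := by
      apply (mul_eq_zero.1 (_ : 2 * G'.val 2 0 = 0)).resolve_left h2
      linear_combination -e2
    rw [e1', e2'] at h00
    field_simp
    linear_combination -h00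

end IsFrame
theorem adjugate_one_add (T : Matrix (Fin 3) (Fin 3) k) :
    (1 + T).adjugate = (1 + T.trace) • 1 + T.adjugate - T := by
  ext i j
  rw [adjugate_fin_three, adjugate_fin_three, trace_fin_three]
  fin_cases i <;> fin_cases j <;> simp <;> ring

theorem mulVec_crossProduct (A : Matrix (Fin 3) (Fin 3) k) (x y : Fin 3 → k) :
    crossProduct (A *ᵥ x) (A *ᵥ y) = A.adjugateᵀ *ᵥ crossProduct x y := by
  ext i
  rw [adjugate_fin_three, cross_apply, cross_apply]
  fin_cases i <;> simp [mulVec, dotProduct, Fin.sum_univ_three] <;> ring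

/-- The eigenvalue `1` of a nontrivial involution of determinant `1` is simple. -/
theorem exists_smul_of_involution (h2 : (2 : k) ≠ 0) {T : Matrix (Fin 3) (Fin 3) k}
    (hT : T * T = 1) (hdet : T.det = 1) (hT1 : T ≠ 1) {x y : Fin 3 → k} (hx0 : x ≠ 0)
    (hx : T *ᵥ x = x) (hy : T *ᵥ y = y) : ∃ c : k, c • x = y := by
  have hadjT : T.adjugate = T := by
    have := T.mul_adjugate
    rw [hdet, one_smul] at this
    calc T.adjugate = T * T * T.adjugate := by rw [hT, one_mul]
      _ = T := by rw [mul_assoc, this, mul_one]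
  have hadj : (1 + T).adjugate = (1 + T.trace) • 1 := by
    rw [adjugate_one_add, hadjT]; simp
  have hN2 : (1 + T) * (1 + T) = (2 : k) • (1 + T) := by
    rw [two_smul]
    calc (1 + T) * (1 + T) = 1 + T + T + T * T := by noncomm_ring
      _ = _ := by rw [hT]; abel
  have hdetN : (1 + T).det = 0 := by
    by_contra h
    apply hT1
    have hu : IsUnit (1 + T) := (Matrix.isUnit_iff_isUnit_det _).2 (isUnit_iff_ne_zero.2 h)
    have h3 : 1 + T = (2 : k) • 1 := by
      apply hu.mul_left_cancel
      rw [hN2]; simp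
    rw [two_smul] at h3
    exact add_left_cancel h3
  have htr : (1 + T.trace) • (1 + T) = 0 := by
    have := (1 + T).mul_adjugate
    rw [hadj, hdetN] at this
    simpa using this
  have hN0 : 1 + T ≠ 0 := by
    intro h
    have hT' : T = -1 := by rw [eq_neg_iff_add_eq_zero, add_comm]; exact h
    rw [hT', det_neg] at hdet
    apply h2
    simp at hdet
    linear_combination -hdet
  have hadj0 : (1 + T).adjugate = 0 := by
    rw [hadj, (smul_eq_zero.1 htr).resolve_right hN0, zero_smul]
  have hcross := mulVec_crossProduct (1 + T) x y
  rw [hadj0, transpose_zero, zero_mulVec, add_mulVec, add_mulVec, one_mulVec, one_mulVec, hx, hy,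
    ← two_smul k x, ← two_smul k y] at hcross
  have hc0 : crossProduct x y = 0 := by
    have h4 : (2 : k) • (2 : k) • crossProduct x y = 0 := by simpa using hcross
    exact (smul_eq_zero.1 ((smul_eq_zero.1 h4).resolve_left h2)).resolve_left h2
  by_contra! hc
  exact crossProduct_ne_zero_iff_linearIndependent.2 ((LinearIndependent.pair_iff' hx0).2 hc) hc0

theorem exists_eigenbasis (h2 : (2 : k) ≠ 0) {Q : Matrix (Fin 3) (Fin 3) k} (hQ : Q.det ≠ 0)
    {α : k} (hα : α ^ 2 - 1 ≠ 0) {s t : GL (Fin 3) k} (hs : s ∈ SO3 k Q) (ht : t ∈ SO3 k Q)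
    (htr : s.val.trace = 1 + 2 * α) (htt : t * t = 1) (ht1 : t ≠ 1) (hst : t * s * t = s⁻¹)
    (hss : s * s ≠ 1) :
    ∃ E : GL (Fin 3) k, s * E = E * stdRot α ∧ t * E = E * stdFlip k := by
  set S := s.val with hS
  set T := t.val with hT
  set R := (s⁻¹ : GL (Fin 3) k).val with hR
  have hTT : T * T = 1 := congrArg Units.val htt
  have hTST : T * S * T = R := congrArg Units.val hst
  have hSR : S * R = 1 := s.mul_inv
  have hRS : R * S = 1 := s.inv_mul
  have hT1 : T ≠ 1 := fun h => ht1 (Units.ext h)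
  have hTS : T * S = R * T := by
    rw [← hTST, mul_assoc (T * S), hTT, mul_one]
  have hTR : T * R = S * T := by
    rw [← hTST, ← mul_assoc, ← mul_assoc, hTT, one_mul]
  have hfix : ∀ x, x ≠ 0 → T *ᵥ x = x → S *ᵥ x = x → False := by
    intro x hx0 hx hxS
    have h1 : S * (1 + T) = 1 + T := by
      apply Matrix.ext_of_mulVec_single
      intro i
      rw [← mulVec_mulVec]
      obtain ⟨c, hc⟩ := exists_smul_of_involution h2 hTT ht.2 hT1 hx0 hx
        (y := (1 + T) *ᵥ Pi.single i 1) (by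
          rw [mulVec_mulVec, mul_add, hTT, mul_one, add_comm])
      rw [← hc, mulVec_smul, hxS]
    have h3 : (1 + T)ᵀ * Q = Q * (1 + T) := by
      have : Tᵀ * Q = Q * T := by
        calc Tᵀ * Q = Tᵀ * Q * T * T := by rw [mul_assoc _ T, hTT, mul_one]
          _ = Q * T := by rw [ht.1]
      rw [transpose_add, transpose_one, add_mul, mul_add, this, one_mul, mul_one]
    have h4 : (1 + T) * S = 1 + T := by
      have hu : IsUnit Q := (Matrix.isUnit_iff_isUnit_det _).2 (isUnit_iff_ne_zero.2 hQ)
      apply hu.mul_left_cancel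
      calc Q * ((1 + T) * S) = (1 + T)ᵀ * Q * S := by rw [h3, mul_assoc]
        _ = (S * (1 + T))ᵀ * Q * S := by rw [h1]
        _ = (1 + T)ᵀ * (Sᵀ * Q * S) := by rw [transpose_mul]; simp only [mul_assoc]
        _ = Q * (1 + T) := by rw [hs.1, h3]
    have h5 : S * T = T * S := by
      have := h1.trans h4.symm
      rw [mul_add, add_mul, mul_one, one_mul] at this
      exact add_left_cancel this
    have h6 : S = R := by rw [← hTST, ← h5, mul_assoc, hTT, mul_one]
    apply hss
    ext1
    rw [Units.val_mul, Units.val_one, ← hSR]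
    conv_rhs => rw [← h6]
  have hCH : (S - 1) * (S + R - (2 * α) • 1) = 0 := by
    have h := Matrix.aeval_self_charpoly S
    rw [SO3.charpoly_eq (isUnit_iff_ne_zero.2 hQ) hs, ← hS, htr, add_sub_cancel_left,
      Polynomial.C_mul'] at h
    simp only [map_mul, map_sub, map_add, map_smul, Polynomial.aeval_X, map_one, map_pow] at h
    calc _ = (S - 1) * ((S ^ 2 - (2 * α) • S + 1) * R) := by
          congr 1
          rw [add_mul, sub_mul, pow_two, mul_assoc, hSR, smul_mul_assoc, hSR]
          simp
          abel
      _ = 0 := by rw [← mul_assoc, h, zero_mul]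
  obtain ⟨u, hu0, huT⟩ := SO3.exists_fixed (isUnit_iff_ne_zero.2 hQ) ht
  obtain ⟨v, hv0, hvS⟩ := SO3.exists_fixed (isUnit_iff_ne_zero.2 hQ) hs
  rw [← hT] at huT
  rw [← hS] at hvS
  have hvTS : S *ᵥ (T *ᵥ v) = T *ᵥ v := by
    have hvR : R *ᵥ v = v := by
      conv_lhs => rw [← hvS]
      rw [mulVec_mulVec, hRS, one_mulVec]
    rw [mulVec_mulVec, ← hTR, ← mulVec_mulVec, hvR]
  set w := v - T *ᵥ v with hw
  have hw0 : w ≠ 0 := fun h => hfix v hv0 (sub_eq_zero.1 h).symm hvS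
  have hwS : S *ᵥ w = w := by rw [hw, mulVec_sub, hvS, hvTS]
  have hwT : T *ᵥ w = -w := by
    rw [hw, mulVec_sub, mulVec_mulVec, hTT, one_mulVec]; abel
  have hRu : S *ᵥ u + R *ᵥ u = (2 * α) • u := by
    by_contra h
    refine hfix ((S + R - (2 * α) • 1) *ᵥ u) ?_ ?_ ?_
    · simpa [sub_mulVec, add_mulVec, sub_eq_zero, smul_mulVec] using h
    · have : T * (S + R - (2 * α) • 1) = (S + R - (2 * α) • 1) * T := by
        rw [mul_sub, mul_add, hTS, hTR, sub_mul, add_mul]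
        simp [add_comm]
      rw [mulVec_mulVec, this, ← mulVec_mulVec, huT]
    · rw [← sub_eq_zero]
      have := congrArg (· *ᵥ u) hCH
      simp only [zero_mulVec] at this
      rw [← this, ← mulVec_mulVec, sub_mulVec S, one_mulVec]
  set e := S *ᵥ u - α • u with he
  have hSu : S *ᵥ u = α • u + e := by rw [he]; abel
  have hRu' : R *ᵥ u = α • u - e := by
    rw [he, ← add_right_inj (S *ᵥ u), hRu, two_mul, add_smul]; abel
  have hTe : T *ᵥ e = -e := by
    rw [he, mulVec_sub, mulVec_smul, huT, mulVec_mulVec, hTS, ← mulVec_mulVec, huT, hRu', he]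
    abel
  have hSe : S *ᵥ e = (α ^ 2 - 1) • u + α • e := by
    have h : e = α • u - R *ᵥ u := by rw [hRu']; abel
    conv_lhs => rw [h]
    rw [mulVec_sub, mulVec_smul, mulVec_mulVec, hSR, one_mulVec, hSu, smul_add, smul_smul,
      sub_smul, one_smul, pow_two]
    abel
  let M : Matrix (Fin 3) (Fin 3) k := of fun i j => ![u i, e i, w i] j
  have hM : ∀ c : Fin 3 → k, M *ᵥ c = c 0 • u + c 1 • e + c 2 • w := by
    intro c
    ext i
    simp [M, mulVec, dotProduct, Fin.sum_univ_three]
    ring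
  have hSM : S * M = M * (stdRot α).val := by
    ext i j
    have h1 := congrFun hSu i
    have h2 := congrFun hSe i
    have h3 := congrFun hwS i
    simp only [mulVec, dotProduct, Fin.sum_univ_three, Pi.add_apply, Pi.smul_apply, smul_eq_mul]
      at h1 h2 h3
    fin_cases j <;> simp [Matrix.mul_apply, Fin.sum_univ_three, M, stdRot]
    · linear_combination h1
    · linear_combination h2
    · linear_combination h3
  have hTM : T * M = M * (stdFlip k).val := by
    ext i j
    have h1 := congrFun huT i
    have h2 := congrFun hTe i
    have h3 := congrFun hwT i
    simp only [mulVec, dotProduct, Fin.sum_univ_three, Pi.neg_apply]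
      at h1 h2 h3
    fin_cases j <;> simp [Matrix.mul_apply, Fin.sum_univ_three, M, stdFlip]
    · linear_combination h1
    · linear_combination h2
    · linear_combination h3
  have hdet : M.det ≠ 0 := by
    intro h
    obtain ⟨c, hc0, hc⟩ := Matrix.exists_mulVec_eq_zero_iff.2 h
    have hker : ∀ c, M *ᵥ c = 0 → c 0 = 0 := by
      intro c hc
      have hc' : M *ᵥ ((stdFlip k).val *ᵥ c) = 0 := by
        rw [mulVec_mulVec, ← hTM, ← mulVec_mulVec, hc, mulVec_zero]
      rw [hM] at hc hc'
      simp [stdFlip, mulVec, dotProduct, Fin.sum_univ_three] at hc'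
      have h3 : (2 : k) • c 0 • u = 0 := by
        rw [two_smul]
        calc c 0 • u + c 0 • u = (c 0 • u + c 1 • e + c 2 • w) +
              (c 0 • u + -(c 1 • e) + -(c 2 • w)) := by abel
          _ = 0 := by rw [hc, hc', add_zero]
      exact (smul_eq_zero.1 ((smul_eq_zero.1 h3).resolve_left h2)).resolve_right hu0
    have h0 := hker c hc
    have h1 : c 1 = 0 := by
      have h3 := hker ((stdRot α).val *ᵥ c)
        (by rw [mulVec_mulVec, ← hSM, ← mulVec_mulVec, hc, mulVec_zero])
      simp [stdRot, mulVec, dotProduct, Fin.sum_univ_three, h0, hα] at h3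
      exact h3
    rw [hM, h0, h1] at hc
    have h22 : c 2 = 0 := by simpa [hw0] using hc
    apply hc0
    ext i
    fin_cases i
    exacts [h0, h1, h22]
  refine ⟨GeneralLinearGroup.mkOfDetNeZero M hdet, Units.ext hSM, Units.ext hTM⟩

theorem exists_isFrame (h2 : (2 : k) ≠ 0) {Q : Matrix (Fin 3) (Fin 3) k} (hsymm : Qᵀ = Q)
    {d : k} (hd : d ≠ 0) (hQ : Q.det = d ^ 2) {α : k} (hα : α ^ 2 - 1 ≠ 0) {s t : GL (Fin 3) k}
    (hs : s ∈ SO3 k Q) (ht : t ∈ SO3 k Q) {E : GL (Fin 3) k}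
    (hsE : s * E = E * stdRot α) (htE : t * E = E * stdFlip k) :
    ∃ a E', IsFrame Q α (Subgroup.closure {s, t}) a E' := by
  set G := E.valᵀ * Q * E.val with hG
  have hGs : (stdRot α).valᵀ * G * (stdRot α).val = G := by
    calc _ = (E.val * (stdRot α).val)ᵀ * Q * (E.val * (stdRot α).val) := by
          rw [hG, transpose_mul]; simp only [mul_assoc]
      _ = (s.val * E.val)ᵀ * Q * (s.val * E.val) := by
          rw [← Units.val_mul, ← hsE, Units.val_mul]
      _ = E.valᵀ * (s.valᵀ * Q * s.val) * E.val := by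
          rw [transpose_mul]; simp only [mul_assoc]
      _ = G := by rw [hs.1]
  have hGt : (stdFlip k).valᵀ * G * (stdFlip k).val = G := by
    calc _ = (E.val * (stdFlip k).val)ᵀ * Q * (E.val * (stdFlip k).val) := by
          rw [hG, transpose_mul]; simp only [mul_assoc]
      _ = (t.val * E.val)ᵀ * Q * (t.val * E.val) := by
          rw [← Units.val_mul, ← htE, Units.val_mul]
      _ = E.valᵀ * (t.valᵀ * Q * t.val) * E.val := by
          rw [transpose_mul]; simp only [mul_assoc]
      _ = G := by rw [ht.1]
  have hGT : Gᵀ = G := by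
    rw [hG, transpose_mul, transpose_mul, transpose_transpose, hsymm, mul_assoc]
  have hGdet : G.det = (E.val.det * d) ^ 2 := by
    rw [hG, det_mul, det_mul, det_transpose, hQ]; ring
  have hDne : E.val.det * d ≠ 0 := mul_ne_zero (Matrix.isUnits_det_units E).ne_zero hd
  clear_value G
  have hsym : ∀ i j, G j i = G i j := fun i j => congrFun (congrFun hGT i) j
  have h01 : G 0 1 = 0 := by
    have := congrFun (congrFun hGt 0) 1
    simp [stdFlip, Matrix.mul_apply, Fin.sum_univ_three] at this
    apply (mul_eq_zero.1 (_ : 2 * G 0 1 = 0)).resolve_left h2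
    linear_combination -this
  have h02 : G 0 2 = 0 := by
    have := congrFun (congrFun hGt 0) 2
    simp [stdFlip, Matrix.mul_apply, Fin.sum_univ_three] at this
    apply (mul_eq_zero.1 (_ : 2 * G 0 2 = 0)).resolve_left h2
    linear_combination -this
  have h11 : G 1 1 = -(α ^ 2 - 1) * G 0 0 := by
    have := congrFun (congrFun hGs 0) 0
    simp [stdRot, Matrix.mul_apply, Fin.sum_univ_three, h01, hsym 0 1] at this
    linear_combination this
  have h12 : G 1 2 = 0 := by
    have := congrFun (congrFun hGs 0) 2
    simpa [stdRot, Matrix.mul_apply, Fin.sum_univ_three, h02] using this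
  rw [det_fin_three, hsym 0 1, hsym 0 2, hsym 1 2, h01, h02, h12, h11] at hGdet
  set D := E.val.det * d with hD
  have ha : G 0 0 ≠ 0 := by
    intro h
    rw [h] at hGdet
    exact pow_ne_zero 2 hDne (by linear_combination -hGdet)
  set g := (α ^ 2 - 1) * G 0 0 * D⁻¹ with hg
  have hg0 : g ≠ 0 := mul_ne_zero (mul_ne_zero hα ha) (inv_ne_zero hDne)
  have hg2 : g ^ 2 * G 2 2 = -(α ^ 2 - 1) := by
    rw [hg]
    field_simp
    linear_combination -hGdet
  let W : GL (Fin 3) k := GeneralLinearGroup.mkOfDetNeZero !![1, 0, 0; 0, 1, 0; 0, 0, g] (by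
    rw [det_fin_three]; simpa using hg0)
  have hWs : W * stdRot α = stdRot α * W := by
    ext i j
    fin_cases i <;> fin_cases j <;>
      simp [W, GeneralLinearGroup.mkOfDetNeZero, stdRot, Matrix.mul_apply, Fin.sum_univ_three]
  have hWt : W * stdFlip k = stdFlip k * W := by
    ext i j
    fin_cases i <;> fin_cases j <;>
      simp [W, GeneralLinearGroup.mkOfDetNeZero, stdFlip, Matrix.mul_apply, Fin.sum_univ_three]
  refine ⟨G 0 0, E * W, ha, ?_, ?_⟩
  · have : (E * W).valᵀ * Q * (E * W).val = W.valᵀ * G * W.val := by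
      rw [hG, Units.val_mul, transpose_mul]; simp only [mul_assoc]
    rw [this]
    ext i j
    fin_cases i <;> fin_cases j <;>
      simp [W, GeneralLinearGroup.mkOfDetNeZero, stdForm, Matrix.mul_apply, Fin.sum_univ_three,
        h01, h02, h12, h11, hsym 0 1, hsym 0 2, hsym 1 2]
    linear_combination hg2
  · rw [stdDihedral, MonoidHom.map_closure, Set.image_pair]
    congr 1
    refine congrArg₂ _ ?_ (congrArg _ ?_)
    · simp only [MulEquiv.coe_toMonoidHom, MulAut.conj_apply]
      rw [eq_mul_inv_iff_mul_eq, ← mul_assoc, hsE, mul_assoc, mul_assoc, hWs]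
    · simp only [MulEquiv.coe_toMonoidHom, MulAut.conj_apply]
      rw [eq_mul_inv_iff_mul_eq, ← mul_assoc, htE, mul_assoc, mul_assoc, hWt]

end

section

theorem DihedralGroup.closure_r_sr {n : ℕ} [NeZero n] {j : ℕ} (hj : j.Coprime n) :
    Subgroup.closure {(r j : DihedralGroup n), sr 0} = ⊤ := by
  rw [eq_top_iff]
  set K := Subgroup.closure {(r j : DihedralGroup n), sr 0}
  have h1 : r j ∈ K := Subgroup.subset_closure (by simp)
  have h2 : sr 0 ∈ K := Subgroup.subset_closure (by simp)
  have hr : ∀ i : ZMod n, r i ∈ K := by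
    intro i
    have h := Subgroup.pow_mem K h1 (((ZMod.unitOfCoprime j hj)⁻¹ : (ZMod n)ˣ).val * i).val
    rwa [r_pow, ZMod.natCast_zmod_val, ← ZMod.coe_unitOfCoprime j hj,
      Units.mul_inv_cancel_left] at h
  rintro (i | i) -
  · exact hr i
  · have h := mul_mem h2 (hr i)
    rwa [sr_mul_r, zero_add] at h

variable {k : Type} [Field k]

theorem sqClass_eq_iff {x y : k} (hx : x ≠ 0) (hy : y ≠ 0) :
    sqClass x hx = sqClass y hy ↔ ∃ c : k, c ≠ 0 ∧ y = c ^ 2 * x := by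
  rw [sqClass, sqClass, QuotientGroup.eq]
  constructor
  · rintro ⟨c, hc⟩
    refine ⟨c, c.ne_zero, ?_⟩
    have := congrArg (fun u : kˣ => x * u) hc
    simp [hx] at this
    rw [← this, mul_comm]
  · rintro ⟨c, hc, h⟩
    refine ⟨Units.mk0 c hc, ?_⟩
    ext
    simp [h]

theorem sqClass_mul {x y : k} (hx : x ≠ 0) (hy : y ≠ 0) :
    sqClass (x * y) (mul_ne_zero hx hy) = sqClass x hx * sqClass y hy := by
  rw [sqClass, sqClass, sqClass, ← QuotientGroup.mk_mul]
  congr 1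
  ext
  simp

theorem sqClass_mul_self (c : SqClasses k) : c * c = 1 := by
  induction c using QuotientGroup.induction_on with
  | H x =>
    rw [← QuotientGroup.mk_mul, QuotientGroup.eq_one_iff]
    exact ⟨x, pow_two x⟩

theorem mem_closure_singleton_iff_of_mul_self {G : Type*} [Group G] {g : G} (hg : g * g = 1)
    {c : G} : c ∈ Subgroup.closure {g} ↔ c = 1 ∨ c = g := by
  rw [Subgroup.mem_closure_singleton]
  constructor
  · rintro ⟨i, rfl⟩
    obtain ⟨j, rfl | rfl⟩ := Int.even_or_odd' i
    · left
      rw [_root_.zpow_mul, zpow_two, hg, _root_.one_zpow]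
    · right
      rw [_root_.zpow_add, _root_.zpow_mul, zpow_two, hg, _root_.one_zpow, one_mul,
        _root_.zpow_one]
  · rintro (rfl | rfl)
    · exact ⟨0, by simp⟩
    · exact ⟨1, by simp⟩

theorem mul_inv_mem_alphaClassSubgroup {α : k} (h : (α + 1) / 2 ≠ 0) {x y : k} (hx : x ≠ 0)
    (hy : y ≠ 0) :
    sqClass x hx * (sqClass y hy)⁻¹ ∈ alphaClassSubgroup k α ↔
      ∃ c : k, c ≠ 0 ∧ (y = c ^ 2 * x ∨ y = c ^ 2 * ((α + 1) / 2 * x)) := by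
  have hset : {c | ∃ h : (α + 1) / 2 ≠ 0, c = sqClass ((α + 1) / 2) h} =
      {sqClass ((α + 1) / 2) h} := by
    ext c; simp [h]
  have hC : ∀ c, c ∈ alphaClassSubgroup k α ↔ c = 1 ∨ c = sqClass ((α + 1) / 2) h := by
    intro c
    rw [alphaClassSubgroup, hset, mem_closure_singleton_iff_of_mul_self (sqClass_mul_self _)]
  rw [hC, mul_inv_eq_one, sqClass_eq_iff, mul_inv_eq_iff_eq_mul]
  have h2 : sqClass x hx = sqClass ((α + 1) / 2) h * sqClass y hy ↔
      sqClass ((α + 1) / 2 * x) (mul_ne_zero h hx) = sqClass y hy := by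
    rw [sqClass_mul h hx, ← inv_mul_eq_iff_eq_mul,
      inv_eq_of_mul_eq_one_left (sqClass_mul_self _)]
  rw [h2, sqClass_eq_iff, ← exists_or]
  simp only [← and_or_left]

end

/-- Suppose `α = (ω + ω⁻¹)/2 ∈ k` for a primitive `n`-th root of unity `ω` (`n ≥ 3`) in an
algebraic closure of `k`, let `β = α² - 1`, and let `q` be a nondegenerate ternary
quadratic form of discriminant `1` such that `SO(q)(k)` contains a subgroup isomorphic to
the dihedral group of order `2n`.  Then the subgroups of `SO(q)(k)` isomorphic to the
dihedral group of order `2n`, modulo conjugation by elements of `SO(q)(k)`, are in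
bijection with the quotient group `D(⟨1,-β⟩)/C`, where `C` is the subgroup generated by
the square class of `(α+1)/2`. -/
theorem dihedral_conjugacy_classes
    (k : Type) [Field k] (hchar : ringChar k ≠ 2) (n : ℕ) (hn : 3 ≤ n)
    (ω : AlgebraicClosure k) (hω : IsPrimitiveRoot ω n)
    (α : k) (hα : algebraMap k (AlgebraicClosure k) α = (ω + ω⁻¹) / 2)
    (β : k) (hβ : β = α ^ 2 - 1)
    (Q : Matrix (Fin 3) (Fin 3) k) (hsymm : Qᵀ = Q)
    (hdisc : ∃ d : k, d ≠ 0 ∧ Q.det = d ^ 2)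
    (hdih : ∃ H : Subgroup (GL (Fin 3) k), H ≤ SO3 k Q ∧
      Nonempty (H ≃* DihedralGroup n)) :
    ∃ f : {H : Subgroup (GL (Fin 3) k) //
            H ≤ SO3 k Q ∧ Nonempty (H ≃* DihedralGroup n)} → SqClasses k,
      (∀ H, f H ∈ binRepClasses k β) ∧
      (∀ d ∈ binRepClasses k β, ∃ H, f H * d⁻¹ ∈ alphaClassSubgroup k α) ∧
      (∀ H₁ H₂, f H₁ * (f H₂)⁻¹ ∈ alphaClassSubgroup k α ↔
        IsConjSubgroup k Q H₁.1 H₂.1) := by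
  have h2 : (2 : k) ≠ 0 := Ring.two_ne_zero hchar
  have : NeZero n := ⟨by omega⟩
  have hω0 : ω ≠ 0 := hω.ne_zero (by omega)
  have hωsq : ω ^ 2 ≠ 1 := fun h => by
    have := Nat.le_of_dvd two_pos (hω.dvd_of_pow_eq_one 2 h)
    omega
  have hω1 : ω ≠ 1 := fun h => hωsq (by rw [h, one_pow])
  have h2K : (2 : AlgebraicClosure k) ≠ 0 := by
    rw [← map_ofNat (algebraMap k (AlgebraicClosure k)) 2]
    exact (map_ne_zero _).2 h2
  have hα1 : α ^ 2 - 1 ≠ 0 := by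
    intro h
    have h3 := congrArg (algebraMap k (AlgebraicClosure k)) h
    rw [map_sub, map_pow, hα, map_one, map_zero] at h3
    field_simp at h3
    apply hωsq
    have h4 : (ω ^ 2 - 1) ^ 2 = 0 := by linear_combination h3
    exact sub_eq_zero.1 (pow_eq_zero_iff two_ne_zero |>.1 h4)
  have hα2 : (α + 1) / 2 ≠ 0 :=
    div_ne_zero (fun h => hα1 (by linear_combination (α - 1) * h)) h2
  subst hβ
  obtain ⟨d, hd, hQ⟩ := hdisc
  have hQ0 : Q.det ≠ 0 := by rw [hQ]; exact pow_ne_zero 2 hd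
  have hframe : ∀ H : Subgroup (GL (Fin 3) k), H ≤ SO3 k Q → Nonempty (H ≃* DihedralGroup n) →
      ∃ a E, IsFrame Q α H a E := by
    rintro H hH ⟨φ⟩
    let ψ : DihedralGroup n →* GL (Fin 3) k := H.subtype.comp φ.symm.toMonoidHom
    have hψ : Function.Injective ψ := H.subtype_injective.comp φ.symm.injective
    have hψH : (⊤ : Subgroup (DihedralGroup n)).map ψ = H := by
      rw [← Subgroup.map_map, Subgroup.map_top_of_surjective _ φ.symm.surjective,
        ← MonoidHom.range_eq_map, Subgroup.range_subtype]
    have hmem : ∀ x, ψ x ∈ SO3 k Q := fun x => hH (φ.symm x).2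
    obtain ⟨j, hj, htr⟩ := SO3.exists_pow_trace_eq (isUnit_iff_ne_zero.2 hQ0)
      (hmem (DihedralGroup.r 1)) (by rw [orderOf_injective ψ hψ, DihedralGroup.orderOf_r_one])
      hω hω1
    rw [← map_pow, DihedralGroup.r_one_pow] at htr
    have htr' : (ψ (DihedralGroup.r j)).val.trace = 1 + 2 * α := by
      apply (algebraMap k (AlgebraicClosure k)).injective
      rw [htr, map_add, map_mul, hα, map_one, map_ofNat]
      field_simp
      ring
    have hss : DihedralGroup.r (j : ZMod n) * DihedralGroup.r (j : ZMod n) ≠ 1 := by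
      rw [DihedralGroup.r_mul_r, DihedralGroup.one_def, Ne, DihedralGroup.r.injEq, ← two_mul,
        ← Nat.cast_ofNat, ← Nat.cast_mul, ZMod.natCast_eq_zero_iff]
      intro h
      have := Nat.le_of_dvd two_pos (hj.symm.dvd_of_dvd_mul_right h)
      omega
    obtain ⟨E, hsE, htE⟩ := exists_eigenbasis h2 hQ0 hα1 (hmem (DihedralGroup.r j))
      (hmem (DihedralGroup.sr 0)) htr'
      (by rw [← map_mul, DihedralGroup.sr_mul_self, map_one])
      (by rw [← map_one ψ, hψ.ne_iff]; exact fun h => by cases h)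
      (by rw [← map_mul, ← map_mul, ← map_inv]; simp)
      (by rw [← map_mul, ← map_one ψ, hψ.ne_iff]; exact hss)
    have h := exists_isFrame h2 hsymm hd hQ hα1 (hmem _) (hmem _) hsE htE
    rwa [← Set.image_pair, ← MonoidHom.map_closure, DihedralGroup.closure_r_sr hj, hψH] at h
  obtain ⟨H₀, hH₀, ⟨φ₀⟩⟩ := hdih
  obtain ⟨a₀, E₀, hE₀⟩ := hframe H₀ hH₀ ⟨φ₀⟩
  choose a E hE using fun H : {H : Subgroup (GL (Fin 3) k) //
    H ≤ SO3 k Q ∧ Nonempty (H ≃* DihedralGroup n)} => hframe H.1 H.2.1 H.2.2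
  refine ⟨fun H => sqClass (a H * a₀) (mul_ne_zero (hE H).ne_zero hE₀.ne_zero), ?_, ?_, ?_⟩
  · intro H
    obtain ⟨x, y, hxy⟩ := hE₀.exists_norm h2 (hE H)
    have heq : a H * a₀ = (a₀ * x) ^ 2 - (α ^ 2 - 1) * (a₀ * y) ^ 2 := by rw [hxy]; ring
    exact ⟨a₀ * x, a₀ * y, heq ▸ mul_ne_zero (hE H).ne_zero hE₀.ne_zero, by simp only [heq]⟩
  · rintro _ ⟨x, y, h, rfl⟩
    have hF := hE₀.mul_stdScale x y h
    obtain ⟨e₁⟩ := hF.nonempty_mulEquiv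
    obtain ⟨e₂⟩ := hE₀.nonempty_mulEquiv
    refine ⟨⟨_, hF.le, ⟨(e₁.trans e₂.symm).trans φ₀⟩⟩, ?_⟩
    rw [mul_inv_mem_alphaClassSubgroup hα2]
    obtain ⟨c, hc, hcc⟩ := (hE ⟨_, hF.le, ⟨(e₁.trans e₂.symm).trans φ₀⟩⟩).eq_sq_mul h2 hα1 hF
    refine ⟨c * a₀⁻¹, mul_ne_zero hc (inv_ne_zero hE₀.ne_zero), ?_⟩
    have ha₀ := hE₀.ne_zero
    refine hcc.imp (fun h => mul_left_cancel₀ ha₀ (h.trans ?_))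
      (fun h => mul_left_cancel₀ ha₀ (h.trans ?_)) <;>
    field_simp
  · intro H₁ H₂
    rw [mul_inv_mem_alphaClassSubgroup hα2]
    have ha₀ := hE₀.ne_zero
    constructor
    · rintro ⟨c, hc, h | h⟩
      · obtain ⟨E', hE'⟩ := (hE H₁).smul_sq hc
        have : a H₂ = c ^ 2 * a H₁ := mul_right_cancel₀ ha₀ (by rw [h]; ring)
        rw [← this] at hE'
        exact hE'.isConjSubgroup hQ0 (hE H₂)
      · obtain ⟨E', hE'⟩ := (hE H₁).bisect h2 (fun h => hα2 (by rw [h, zero_div]))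
        obtain ⟨E', hE'⟩ := hE'.smul_sq hc
        have : a H₂ = c ^ 2 * (a H₁ * ((α + 1) / 2)) := mul_right_cancel₀ ha₀ (by rw [h]; ring)
        rw [← this] at hE'
        exact hE'.isConjSubgroup hQ0 (hE H₂)
    · rintro ⟨P, hP, hPx⟩
      obtain ⟨c, hc, h⟩ := (hE H₁).eq_sq_mul h2 hα1 ((hE H₂).transport hP hPx)
      exact ⟨c, hc, h.imp (fun h => by rw [h]; ring) (fun h => by rw [h]; ring)⟩
end

section
/- Let k be a field with char(k) ≠ 2, 3, 5 and let q be a nondegenerate ternary quadratic form over k of discriminant 1. For each G among the alternating group A₄, the symmetric group S₄, and the alternating group A₅: any two subgroups H₁, H₂ of SO(q)(k) that are both isomorphic to G are conjugate in SO(q)(k), i.e., there exists P ∈ SO(q)(k) with P⁻¹H₁P = H₂. -/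
open Matrix

/-- The diagonal half-turn `diag(1, -1, -1)`. -/
def halfTurn (k : Type) [Field k] : Matrix (Fin 3) (Fin 3) k := !![1, 0, 0; 0, -1, 0; 0, 0, -1]

/-- The rotation permuting the coordinate axes cyclically. -/
def cyclicTurn (k : Type) [Field k] : Matrix (Fin 3) (Fin 3) k := !![0, 0, 1; 1, 0, 0; 0, 1, 0]

/-- The circulant-type symmetric matrix whose `(i, j)` entry depends on `i + j` only. -/
def antiCirculant {k : Type} (a b c : k) : Matrix (Fin 3) (Fin 3) k := !![a, b, c; b, c, a; c, a, b]

/-- Elements `v`, `g` of a group satisfying the relations of the generators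
`(0 1)(2 3)`, `(0 1 2)` of the alternating group on four letters. -/
structure IsTetrahedral {G : Type} [Group G] (v g : G) : Prop where
  ne_one : v ≠ 1
  v_sq : v * v = 1
  g_cube : g * g * g = 1
  vg_cube : v * g * (v * g) * (v * g) = 1

theorem IsTetrahedral.map {G G' : Type} [Group G] [Group G'] {v g : G} (h : IsTetrahedral v g)
    (f : G →* G') (hf : Function.Injective f) : IsTetrahedral (f v) (f g) where
  ne_one := fun h0 => h.ne_one (hf (by rw [h0, map_one]))
  v_sq := by rw [← map_mul, h.v_sq, map_one]
  g_cube := by simp only [← map_mul, h.g_cube, map_one]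
  vg_cube := by simp only [← map_mul, h.vg_cube, map_one]

/-- `E` is a basis of determinant `δ`, orthonormal for `Q`, in which `A` and `B` become the
standard half-turn and the standard cyclic rotation. -/
structure IsFrame_s12 {k : Type} [Field k] (Q : Matrix (Fin 3) (Fin 3) k) (δ : k)
    (A B E : GL (Fin 3) k) : Prop where
  orthonormal : (E : Matrix (Fin 3) (Fin 3) k)ᵀ * Q * (E : Matrix (Fin 3) (Fin 3) k) = 1
  det_eq : (E : Matrix (Fin 3) (Fin 3) k).det = δ
  half : (A : Matrix (Fin 3) (Fin 3) k) * E = E * halfTurn k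
  cyclic : (B : Matrix (Fin 3) (Fin 3) k) * E = E * cyclicTurn k

section

variable {k : Type} [Field k] {Q : Matrix (Fin 3) (Fin 3) k}

/-- The conjugates of `v` under the powers of `g` multiply as the involutions of a Klein group. -/
theorem IsTetrahedral.klein {G : Type} [Group G] {v g : G} (h : IsTetrahedral v g) :
    v * (g * v * g⁻¹) = g⁻¹ * v * g ∧ v * (g⁻¹ * v * g) = g * v * g⁻¹ ∧
      g * v * g⁻¹ * v = g⁻¹ * v * g := by
  have hv : v⁻¹ = v := inv_eq_of_mul_eq_one_left h.v_sq
  have hg : g * g = g⁻¹ := eq_inv_of_mul_eq_one_left h.g_cube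
  have key : v * (g * v * g⁻¹) = g⁻¹ * v * g := by
    have h1 : v * (g * v * g⁻¹) = (v * g * (v * g) * (v * g)) * (g⁻¹ * v⁻¹ * (g * g)⁻¹) := by
      group
    rw [h1, h.vg_cube, hg, hv]; group
  refine ⟨key, ?_, ?_⟩
  · rw [← key, ← mul_assoc, h.v_sq, one_mul]
  · have h1 : g * v * g⁻¹ * v = (v⁻¹ * (g * v⁻¹ * g⁻¹))⁻¹ := by group
    have h2 : g⁻¹ * v * g = (g⁻¹ * v⁻¹ * g)⁻¹ := by group
    rw [h1, h2, hv, key]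

/-- A vector fixed by `A` and negated by the two nontrivial conjugates of `A` under `B`. -/
theorem exists_axis (h2 : (2 : k) ≠ 0) {A B : GL (Fin 3) k} (h : IsTetrahedral A B) :
    ∃ u : Fin 3 → k, u ≠ 0 ∧ A.1 *ᵥ u = u ∧ A.1 *ᵥ (B.1 *ᵥ u) = -(B.1 *ᵥ u) ∧
      A.1 *ᵥ (B.1 *ᵥ (B.1 *ᵥ u)) = -(B.1 *ᵥ (B.1 *ᵥ u)) := by
  obtain ⟨hac, hae, hca⟩ := h.klein
  have hBi : B⁻¹ = B * B := inv_eq_of_mul_eq_one_left h.g_cube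
  obtain ⟨C, hC⟩ : ∃ C, C = B * A * B⁻¹ := ⟨_, rfl⟩
  obtain ⟨F, hF⟩ : ∃ F, F = B⁻¹ * A * B := ⟨_, rfl⟩
  have hAB : A * B = B * F := by rw [hF]; group
  have hAB2 : A * (B * B) = B * B * C := by rw [hC, ← hBi]; group
  have hCB : B * A = C * B := by rw [hC]; group
  have hFB : B * C = F * B := by
    have : B * (B * A) = B⁻¹ * A := by rw [hBi, mul_assoc]
    rw [hC, hF, ← mul_assoc, this, hBi]
    group
  rw [← hC, ← hF] at hac hae hca
  have hAA := h.v_sq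
  have hCC : C * C = 1 := by
    have : C * C = B * (A * A) * B⁻¹ := by rw [hC]; group
    rw [this, hAA]; group
  have hFF : F * F = 1 := by
    have : F * F = B⁻¹ * (A * A) * B := by rw [hF]; group
    rw [this, hAA]; group
  have hCF : C * F = A := by rw [← hca, ← mul_assoc, hCC, one_mul]
  have hFC : F * C = A := by rw [← hac, mul_assoc, hCC, mul_one]
  have hFA : F * A = C := by rw [← hca, mul_assoc, hAA, mul_one]
  have hne : A.1 ≠ 1 := fun h0 => h.ne_one (Units.ext h0)
  replace hAB := congrArg Units.val hAB
  replace hAB2 := congrArg Units.val hAB2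
  replace hCB := congrArg Units.val hCB
  replace hFB := congrArg Units.val hFB
  replace hac := congrArg Units.val hac
  replace hae := congrArg Units.val hae
  replace hca := congrArg Units.val hca
  replace hAA := congrArg Units.val hAA
  replace hCC := congrArg Units.val hCC
  replace hFF := congrArg Units.val hFF
  replace hCF := congrArg Units.val hCF
  replace hFC := congrArg Units.val hFC
  replace hFA := congrArg Units.val hFA
  have hB3 := congrArg Units.val h.g_cube
  simp only [Units.val_mul, Units.val_one] at *
  generalize A.1 = a at *
  generalize B.1 = b at *
  generalize C.1 = c at *
  generalize F.1 = f at *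
  obtain ⟨p, hp⟩ : ∃ p, p = 1 + a - c - f := ⟨_, rfl⟩
  have hap : a * p = p := by
    rw [hp]; simp only [mul_add, mul_sub, mul_one, hAA, hac, hae]; abel
  have hcp : c * p = -p := by
    rw [hp]; simp only [mul_add, mul_sub, mul_one, hca, hCC, hCF]; abel
  have hfp : f * p = -p := by
    rw [hp]; simp only [mul_add, mul_sub, mul_one, hFA, hFC, hFF]; abel
  have hp0 : p ≠ 0 := by
    intro h0
    rw [h0] at hp
    have hbp : (1 + c - f - a) * b = 0 := by
      have : (1 + c - f - a) * b = b * (1 + a - c - f) := by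
        simp only [mul_add, add_mul, mul_sub, sub_mul, one_mul, mul_one, hCB, hFB, hAB]
      rw [this, ← hp, mul_zero]
    have hq : 1 + c - f - a = 0 := by
      have := congrArg (· * (b * b)) hbp
      simpa only [mul_assoc, ← mul_assoc b, hB3, mul_one, zero_mul] using this
    have hcf : c = a := by
      have h4 : (2 : k) • (c - a) = 0 := by
        have : (2 : k) • (c - a) = (1 + c - f - a) - (1 + a - c - f) := by
          rw [two_smul]; abel
        rw [this, hq, ← hp, sub_zero]
      exact sub_eq_zero.1 ((smul_eq_zero.1 h4).resolve_left h2)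
    rw [hcf] at hac hp
    rw [hAA] at hac
    rw [hcf, hCB, hcf] at hFB
    have hfa := congrArg (· * (b * b)) hFB
    simp only [mul_assoc, ← mul_assoc b, hB3, mul_one] at hfa
    exact hne (hfa.trans hac.symm)
  obtain ⟨w, hw⟩ : ∃ w : Fin 3 → k, p *ᵥ w ≠ 0 := by
    by_contra! hcon
    exact hp0 (Matrix.ext_of_mulVec_single fun i => by rw [hcon, zero_mulVec])
  refine ⟨p *ᵥ w, hw, ?_, ?_, ?_⟩
  · rw [mulVec_mulVec, hap]
  · simp only [mulVec_mulVec, ← neg_mulVec]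
    rw [← mul_assoc, hAB, mul_assoc, hfp, mul_neg]
  · simp only [mulVec_mulVec, ← neg_mulVec]
    rw [← mul_assoc b, ← mul_assoc, hAB2, mul_assoc, hcp, mul_neg]

theorem exists_isFrame_s12 (h2 : (2 : k) ≠ 0) (hsymm : Qᵀ = Q) {δ : k} (hδ : δ ≠ 0)
    (hdet : Q.det * δ ^ 2 = 1) {A B : GL (Fin 3) k} (hA : A ∈ SO3 k Q) (hB : B ∈ SO3 k Q)
    (h : IsTetrahedral A B) : ∃ E, IsFrame_s12 Q δ A B E := by
  obtain ⟨u, hu, h1, h2', h3⟩ := exists_axis h2 h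
  obtain ⟨v, hv⟩ : ∃ v, v = B.1 *ᵥ u := ⟨_, rfl⟩
  obtain ⟨w, hw⟩ : ∃ w, w = B.1 *ᵥ v := ⟨_, rfl⟩
  rw [← hv] at h2' h3
  rw [← hw] at h3
  have hBw : B.1 *ᵥ w = u := by
    have := congrArg Units.val h.g_cube
    simp only [Units.val_mul, Units.val_one] at this
    rw [hw, hv, mulVec_mulVec, mulVec_mulVec, this, one_mulVec]
  let E₀ : Matrix (Fin 3) (Fin 3) k := (Matrix.of ![u, v, w])ᵀ
  have hcol (M : Matrix (Fin 3) (Fin 3) k) :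
      M * E₀ = (Matrix.of ![M *ᵥ u, M *ᵥ v, M *ᵥ w])ᵀ := by
    ext i j
    fin_cases j <;> simp [E₀, Matrix.mul_apply, mulVec, dotProduct]
  have hAE : A.1 * E₀ = E₀ * halfTurn k := by
    rw [hcol, h1, h2', h3]
    ext i j
    fin_cases j <;> simp [E₀, halfTurn, Matrix.mul_apply, Fin.sum_univ_three]
  have hBE : B.1 * E₀ = E₀ * cyclicTurn k := by
    rw [hcol, ← hv, ← hw, hBw]
    ext i j
    fin_cases j <;> simp [E₀, cyclicTurn, Matrix.mul_apply, Fin.sum_univ_three]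
  have hQ0 : Q.det ≠ 0 := fun h0 => by simp [h0] at hdet
  obtain ⟨R, hR⟩ : ∃ R, R = E₀ᵀ * Q * E₀ := ⟨_, rfl⟩
  have hinv {M : GL (Fin 3) k} (hM : M ∈ SO3 k Q) {N : Matrix (Fin 3) (Fin 3) k}
      (hN : M.1 * E₀ = E₀ * N) : Nᵀ * R * N = R := by
    have : Nᵀ * R * N = (E₀ * N)ᵀ * Q * (E₀ * N) := by
      rw [hR, transpose_mul]; simp only [mul_assoc]
    rw [this, ← hN, transpose_mul, hR]
    conv_rhs => rw [← hM.1]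
    simp only [mul_assoc]
  have hRs : Rᵀ = R := by
    rw [hR, transpose_mul, transpose_mul, transpose_transpose, hsymm, mul_assoc]
  obtain ⟨r, hr⟩ : ∃ r, R = r • (1 : Matrix (Fin 3) (Fin 3) k) := by
    have hD := hinv hA hAE
    have hC := hinv hB hBE
    refine ⟨R 0 0, ?_⟩
    have d01 := congrFun (congrFun hD 0) 1
    have d02 := congrFun (congrFun hD 0) 2
    simp [halfTurn, Matrix.mul_apply, Fin.sum_univ_three] at d01 d02
    have h01 : R 0 1 = 0 :=
      (mul_eq_zero.1 (by linear_combination -d01 : 2 * R 0 1 = 0)).resolve_left h2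
    have h02 : R 0 2 = 0 :=
      (mul_eq_zero.1 (by linear_combination -d02 : 2 * R 0 2 = 0)).resolve_left h2
    have s (i j : Fin 3) : R j i = R i j := congrFun (congrFun hRs i) j
    have e00 := congrFun (congrFun hC 0) 0
    have e11 := congrFun (congrFun hC 1) 1
    have e01 := congrFun (congrFun hC 0) 1
    simp [cyclicTurn, Matrix.mul_apply, Fin.sum_univ_three] at e00 e11 e01
    ext i j
    fin_cases i <;> fin_cases j <;>
      simp [h01, h02, s 0 1, s 0 2, s 1 2, e00, e11, e01]
  have hE0 : E₀.det ≠ 0 := by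
    intro h0
    obtain ⟨x, hx, hEx⟩ := Matrix.exists_mulVec_eq_zero_iff.2 h0
    have hfix (y : Fin 3 → k) (hy : E₀ *ᵥ y = 0) : y 0 = 0 := by
      have h4 : (2 * y 0) • u = E₀ *ᵥ y + A.1 *ᵥ (E₀ *ᵥ y) := by
        rw [mulVec_mulVec, hAE]
        ext i
        simp [E₀, halfTurn, Matrix.mul_apply, Fin.sum_univ_three, mulVec, dotProduct]
        ring
      rw [hy, mulVec_zero, add_zero, smul_eq_zero] at h4
      exact (mul_eq_zero.1 (h4.resolve_right hu)).resolve_left h2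
    have hrot (y : Fin 3 → k) (hy : E₀ *ᵥ y = 0) : E₀ *ᵥ (cyclicTurn k *ᵥ y) = 0 := by
      rw [mulVec_mulVec, ← hBE, ← mulVec_mulVec, hy, mulVec_zero]
    have x0 := hfix _ hEx
    have x2 := hfix _ (hrot _ hEx)
    have x1 := hfix _ (hrot _ (hrot _ hEx))
    simp [cyclicTurn, mulVec, dotProduct, Fin.sum_univ_three] at x1 x2
    apply hx
    ext i
    fin_cases i
    · exact x0
    · exact x1
    · exact x2
  have hrd : E₀.det ^ 2 * Q.det = r ^ 3 := by
    have := congrArg Matrix.det (hR.symm.trans hr)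
    simp only [det_mul, det_transpose, det_smul, det_one, Fintype.card_fin] at this
    linear_combination this
  have hr0 : r ≠ 0 := by
    rintro rfl
    simp [hE0, hQ0] at hrd
  obtain ⟨s, hs⟩ : ∃ s, s = δ * r / E₀.det := ⟨_, rfl⟩
  have hsr : s ^ 2 * r = 1 := by
    rw [hs]
    field_simp
    linear_combination -δ ^ 2 * hrd + E₀.det ^ 2 * hdet
  have hsd : s ^ 3 * E₀.det = δ := by
    have : s * E₀.det = δ * r := by rw [hs]; field_simp
    linear_combination s ^ 2 * this + δ * hsr
  have hsE : (s • E₀).det = δ := by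
    rw [det_smul, Fintype.card_fin, hsd]
  refine ⟨GeneralLinearGroup.mkOfDetNeZero (s • E₀) (hsE ▸ hδ), ?_, hsE, ?_, ?_⟩
  · change (s • E₀)ᵀ * Q * (s • E₀) = 1
    rw [transpose_smul, smul_mul, smul_mul, Matrix.mul_smul, ← hR, hr, smul_smul, smul_smul,
      ← sq, hsr, one_smul]
  · change A.1 * (s • E₀) = s • E₀ * halfTurn k
    rw [Matrix.mul_smul, smul_mul, hAE]
  · change B.1 * (s • E₀) = s • E₀ * cyclicTurn k
    rw [Matrix.mul_smul, smul_mul, hBE]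

/-- The matrix of a rotation in an orthonormal frame. -/
theorem IsFrame_s12.exists_matrix {δ : k} {A B E M : GL (Fin 3) k} (h : IsFrame_s12 Q δ A B E)
    (hM : M ∈ SO3 k Q) : ∃ N : Matrix (Fin 3) (Fin 3) k, M.1 * E.1 = E.1 * N ∧
      Nᵀ * N = 1 ∧ N.det = 1 := by
  have hMN : M.1 * E.1 = E.1 * (E⁻¹ * M * E).1 := by
    rw [← Units.val_mul, ← Units.val_mul]
    congr 1
    group
  refine ⟨(E⁻¹ * M * E).1, hMN, ?_, ?_⟩
  · generalize (E⁻¹ * M * E).1 = N at *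
    calc Nᵀ * N = Nᵀ * (E.1ᵀ * Q * E.1) * N := by rw [h.orthonormal, mul_one]
      _ = (E.1 * N)ᵀ * Q * (E.1 * N) := by rw [transpose_mul]; simp only [mul_assoc]
      _ = E.1ᵀ * (M.1ᵀ * Q * M.1) * E.1 := by
        rw [← hMN, transpose_mul]; simp only [mul_assoc]
      _ = 1 := by rw [hM.1, h.orthonormal]
  · rw [Units.val_mul, Units.val_mul, det_mul, det_mul, hM.2, mul_one, ← det_mul,
      ← Units.val_mul, inv_mul_cancel, Units.val_one, det_one]

/-- If `T` inverts the cyclic rotation `B` by conjugation, its matrix is anticirculant. -/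
theorem IsFrame_s12.exists_antiCirculant {δ : k} {A B E T : GL (Fin 3) k} (h : IsFrame_s12 Q δ A B E)
    (hT : T ∈ SO3 k Q) (hTB : B * T * B = T) : ∃ a b c : k,
      T.1 * E.1 = E.1 * antiCirculant a b c ∧ a ^ 2 + b ^ 2 + c ^ 2 = 1 ∧
      a * b + b * c + c * a = 0 ∧ a + b + c = -1 := by
  obtain ⟨N, hN, ho, hd⟩ := h.exists_matrix hT
  have hCN : cyclicTurn k * N * cyclicTurn k = N := by
    apply E.isUnit.mul_left_cancel
    have h1 := congrArg Units.val hTB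
    simp only [Units.val_mul] at h1
    rw [← mul_assoc, ← mul_assoc, ← h.cyclic, mul_assoc B.1, ← hN, mul_assoc, mul_assoc,
      ← h.cyclic, ← mul_assoc, ← mul_assoc, h1, hN]
  have e (i j : Fin 3) := congrFun (congrFun hCN i) j
  have hNa : N = antiCirculant (N 0 0) (N 0 1) (N 0 2) := by
    have e00 := e 0 0
    have e01 := e 0 1
    have e02 := e 0 2
    have e10 := e 1 0
    have e11 := e 1 1
    have e12 := e 1 2
    have e20 := e 2 0
    have e21 := e 2 1
    have e22 := e 2 2
    simp [cyclicTurn, Matrix.mul_apply, Fin.sum_univ_three, vecMul, dotProduct]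
      at e00 e01 e02 e10 e11 e12 e20 e21 e22
    ext i j
    fin_cases i <;> fin_cases j <;> simp [antiCirculant] <;> grind
  generalize N 0 0 = a at *
  generalize N 0 1 = b at *
  generalize N 0 2 = c at *
  subst hNa
  have o00 := congrFun (congrFun ho 0) 0
  have o01 := congrFun (congrFun ho 0) 1
  simp [antiCirculant, Matrix.mul_apply, Fin.sum_univ_three] at o00 o01
  simp [antiCirculant, det_fin_three] at hd
  have ho1 : a * b + b * c + c * a = 0 := by linear_combination o01
  have ho0 : a ^ 2 + b ^ 2 + c ^ 2 = 1 := by linear_combination o00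
  refine ⟨a, b, c, hN, ho0, ho1, ?_⟩
  linear_combination (-1 : k) * hd - (a + b + c) * ho0 + (a + b + c) * ho1

theorem IsFrame_s12.octahedral (h2 : (2 : k) ≠ 0) {δ : k} {A B E T : GL (Fin 3) k}
    (h : IsFrame_s12 Q δ A B E) (hT : T ∈ SO3 k Q) (hTB : B * T * B = T) (hTA : T * A = A * T) :
    T.1 * E.1 = E.1 * antiCirculant (-1) 0 0 := by
  obtain ⟨a, b, c, hN, -, -, hs⟩ := h.exists_antiCirculant hT hTB
  have hc : antiCirculant a b c * halfTurn k = halfTurn k * antiCirculant a b c := by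
    apply E.isUnit.mul_left_cancel
    have h1 := congrArg Units.val hTA
    simp only [Units.val_mul] at h1
    rw [← mul_assoc, ← mul_assoc, ← h.half, ← hN, mul_assoc, mul_assoc, ← h.half, ← hN,
      ← mul_assoc, h1, mul_assoc]
  have e01 := congrFun (congrFun hc 0) 1
  have e02 := congrFun (congrFun hc 0) 2
  simp [antiCirculant, halfTurn, Matrix.mul_apply, Fin.sum_univ_three] at e01 e02
  have hb : b = 0 := (mul_eq_zero.1 (by linear_combination -e01 : 2 * b = 0)).resolve_left h2
  have hc : c = 0 := (mul_eq_zero.1 (by linear_combination -e02 : 2 * c = 0)).resolve_left h2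
  have ha : a = -1 := by linear_combination hs - hb - hc
  rw [hN, ha, hb, hc]

theorem IsFrame_s12.icosahedral (h2 : (2 : k) ≠ 0) {δ : k} {A B E T : GL (Fin 3) k}
    (h : IsFrame_s12 Q δ A B E) (hT : T ∈ SO3 k Q) (hTB : B * T * B = T)
    (hTA : T * A * (T * A) * (T * A) = 1) :
    ∃ b : k, T.1 * E.1 = E.1 * antiCirculant (-1 / 2) b (-1 / 2 - b) ∧
      4 * b ^ 2 + 2 * b - 1 = 0 := by
  obtain ⟨a, b, c, hN, hn, ho, hs⟩ := h.exists_antiCirculant hT hTB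
  obtain ⟨X, hX⟩ : ∃ X, X = antiCirculant a b c * halfTurn k := ⟨_, rfl⟩
  have hTAE : (T * A).1 * E.1 = E.1 * X := by
    rw [Units.val_mul, mul_assoc, h.half, ← mul_assoc, hN, mul_assoc, hX]
  have hX3 : X * X * X = 1 := by
    apply E.isUnit.mul_left_cancel
    have h1 := congrArg Units.val hTA
    rw [Units.val_mul, Units.val_mul _ (T * A), Units.val_one] at h1
    rw [← mul_assoc, ← mul_assoc, ← hTAE, mul_assoc _ E.1, ← hTAE, mul_assoc, mul_assoc,
      ← hTAE, ← mul_assoc, ← mul_assoc, h1, one_mul, mul_one]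
  have hXX : X * Xᵀ = 1 := by
    ext i j
    fin_cases i <;> fin_cases j <;>
      simp [hX, antiCirculant, halfTurn, Matrix.mul_apply, Fin.sum_univ_three] <;> grind
  have hX2 : X * X = Xᵀ := by
    calc X * X = X * X * X * Xᵀ := by rw [mul_assoc _ X, hXX, mul_one]
      _ = Xᵀ := by rw [hX3, one_mul]
  have e00 := congrFun (congrFun hX2 0) 0
  have e01 := congrFun (congrFun hX2 1) 0
  have e02 := congrFun (congrFun hX2 2) 0
  simp [hX, antiCirculant, halfTurn, Matrix.mul_apply, Fin.sum_univ_three] at e00 e01 e02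
  have ha : 2 * a + 1 = 0 := by
    by_contra h0
    have hb : b = 0 :=
      (mul_eq_zero.1 (by linear_combination e01 + ho : (2 * a + 1) * b = 0)).resolve_left h0
    have hc : c = 0 :=
      (mul_eq_zero.1 (by linear_combination e02 + ho : (2 * a + 1) * c = 0)).resolve_left h0
    subst hb hc
    have ha : a = -1 := by linear_combination hs
    subst ha
    exact h2 (by linear_combination e00)
  have ha' : a = -1 / 2 := by field_simp; linear_combination ha
  have hc : c = -1 / 2 - b := by field_simp; linear_combination 2 * hs - ha
  refine ⟨b, by rw [hN, ha', hc], ?_⟩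
  rw [ha', hc] at ho
  field_simp at ho
  linear_combination -ho

theorem IsFrame_s12.mul_inv_mem {δ : k} {A₁ B₁ E₁ A₂ B₂ E₂ : GL (Fin 3) k}
    (h₁ : IsFrame_s12 Q δ A₁ B₁ E₁) (h₂ : IsFrame_s12 Q δ A₂ B₂ E₂) : E₁ * E₂⁻¹ ∈ SO3 k Q := by
  have hE : E₂.1 * (E₂⁻¹).1 = 1 := E₂.mul_inv
  constructor
  · calc (E₁ * E₂⁻¹).1ᵀ * Q * (E₁ * E₂⁻¹).1
        = (E₂⁻¹).1ᵀ * (E₁.1ᵀ * Q * E₁.1) * (E₂⁻¹).1 := by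
          rw [Units.val_mul, transpose_mul]; simp only [mul_assoc]
      _ = (E₂.1 * (E₂⁻¹).1)ᵀ * Q * (E₂.1 * (E₂⁻¹).1) := by
          rw [h₁.orthonormal, ← h₂.orthonormal, transpose_mul]; simp only [mul_assoc]
      _ = Q := by rw [hE, transpose_one, one_mul, mul_one]
  · have h := congrArg Matrix.det hE
    rw [det_mul, h₂.det_eq, det_one] at h
    rw [Units.val_mul, det_mul, h₁.det_eq, h]

/-- The half-turn exchanging the last two coordinate axes. -/
def swapTurn (k : Type) [Field k] : GL (Fin 3) k where
  val := antiCirculant (-1) 0 0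
  inv := antiCirculant (-1) 0 0
  val_inv := by
    ext i j
    fin_cases i <;> fin_cases j <;> simp [antiCirculant, Matrix.mul_apply, Fin.sum_univ_three]
  inv_val := by
    ext i j
    fin_cases i <;> fin_cases j <;> simp [antiCirculant, Matrix.mul_apply, Fin.sum_univ_three]

theorem IsFrame_s12.mul_swapTurn {δ : k} {A B E : GL (Fin 3) k} (h : IsFrame_s12 Q δ A B E) :
    IsFrame_s12 Q δ A B⁻¹ (E * swapTurn k) where
  orthonormal := by
    rw [Units.val_mul, transpose_mul]
    calc (swapTurn k).1ᵀ * E.1ᵀ * Q * (E.1 * (swapTurn k).1)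
        = (swapTurn k).1ᵀ * (E.1ᵀ * Q * E.1) * (swapTurn k).1 := by simp only [mul_assoc]
      _ = (swapTurn k).1ᵀ * (swapTurn k).1 := by rw [h.orthonormal, mul_one]
      _ = 1 := by
        ext i j
        fin_cases i <;> fin_cases j <;>
          simp [swapTurn, antiCirculant, Matrix.mul_apply, Fin.sum_univ_three]
  det_eq := by
    rw [Units.val_mul, det_mul, h.det_eq]
    simp [swapTurn, antiCirculant, det_fin_three]
  half := by
    have hc : halfTurn k * (swapTurn k).1 = (swapTurn k).1 * halfTurn k := by
      ext i j
      fin_cases i <;> fin_cases j <;>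
        simp [swapTurn, halfTurn, antiCirculant, Matrix.mul_apply, Fin.sum_univ_three]
    rw [Units.val_mul, ← mul_assoc, h.half, mul_assoc, hc, mul_assoc]
  cyclic := by
    have hc : cyclicTurn k * ((swapTurn k).1 * cyclicTurn k) = (swapTurn k).1 := by
      ext i j
      fin_cases i <;> fin_cases j <;>
        simp [swapTurn, cyclicTurn, antiCirculant, Matrix.mul_apply, Fin.sum_univ_three]
    apply B.isUnit.mul_left_cancel
    rw [← mul_assoc, ← Units.val_mul, mul_inv_cancel, Units.val_one, one_mul, Units.val_mul,
      mul_assoc, ← mul_assoc B.1, h.cyclic, mul_assoc, hc]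

theorem antiCirculant_mul_swapTurn (a b c : k) :
    antiCirculant a b c * (swapTurn k).1 = (swapTurn k).1 * antiCirculant a c b := by
  ext i j
  fin_cases i <;> fin_cases j <;>
    simp [swapTurn, antiCirculant, Matrix.mul_apply, Fin.sum_univ_three]

end

section

variable {k : Type} [Field k]

theorem conj_eq_of_mul_eq {E₁ E₂ A₁ A₂ : GL (Fin 3) k} {N : Matrix (Fin 3) (Fin 3) k}
    (h₁ : A₁.1 * E₁.1 = E₁.1 * N) (h₂ : A₂.1 * E₂.1 = E₂.1 * N) :
    E₁ * E₂⁻¹ * A₂ * (E₁ * E₂⁻¹)⁻¹ = A₁ := by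
  have key {E A : GL (Fin 3) k} (h : A.1 * E.1 = E.1 * N) : (E⁻¹ * A * E).1 = N := by
    rw [mul_assoc, Units.val_mul, Units.val_mul, h, ← mul_assoc, ← Units.val_mul,
      inv_mul_cancel, Units.val_one, one_mul]
  have h : E₁⁻¹ * A₁ * E₁ = E₂⁻¹ * A₂ * E₂ := Units.ext ((key h₁).trans (key h₂).symm)
  calc E₁ * E₂⁻¹ * A₂ * (E₁ * E₂⁻¹)⁻¹ = E₁ * (E₂⁻¹ * A₂ * E₂) * E₁⁻¹ := by group
    _ = A₁ := by rw [← h]; group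

/-- Two homomorphisms that are conjugate on a generating set have conjugate ranges. -/
theorem mem_range_iff_conj_mem_range {G G' : Type} [Group G] [Group G'] {φ₁ φ₂ : G →* G'}
    {S : Set G} (hS : Subgroup.closure S = ⊤) {P : G'}
    (h : ∀ s ∈ S, P * φ₂ s * P⁻¹ = φ₁ s) (x : G') :
    x ∈ φ₂.range ↔ P * x * P⁻¹ ∈ φ₁.range := by
  have hφ : (MulAut.conj P).toMonoidHom.comp φ₂ = φ₁ :=
    MonoidHom.eq_of_eqOn_dense hS fun s hs => by simpa using h s hs
  rw [← hφ]
  constructor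
  · rintro ⟨y, rfl⟩
    exact ⟨y, by simp⟩
  · rintro ⟨y, hy⟩
    exact ⟨y, by simpa using hy⟩

theorem exists_injective_range_eq {G G' : Type} [Group G] [Group G'] {H : Subgroup G'}
    (h : Nonempty (H ≃* G)) : ∃ φ : G →* G', Function.Injective φ ∧ φ.range = H := by
  obtain ⟨e⟩ := h
  refine ⟨H.subtype.comp e.symm.toMonoidHom,
    H.subtype_injective.comp e.symm.injective, ?_⟩
  rw [MonoidHom.range_comp, MonoidHom.range_eq_top.2 e.symm.surjective,
    ← MonoidHom.range_eq_map, H.range_subtype]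

end

open Equiv Equiv.Perm

section

/-- The double transposition `(0 1)(2 3)` in `A₄`. -/
def a4Double : alternatingGroup (Fin 4) := ⟨swap 0 1 * swap 2 3, mem_alternatingGroup.2 (by decide)⟩

/-- The three-cycle `(0 1 2)` in `A₄`. -/
def a4Three : alternatingGroup (Fin 4) := ⟨swap 0 1 * swap 1 2, mem_alternatingGroup.2 (by decide)⟩

/-- The double transposition `(0 1)(2 3)` in `A₅`. -/
def a5Double : alternatingGroup (Fin 5) := ⟨swap 0 1 * swap 2 3, mem_alternatingGroup.2 (by decide)⟩

/-- The three-cycle `(0 1 2)` in `A₅`. -/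
def a5Three : alternatingGroup (Fin 5) := ⟨swap 0 1 * swap 1 2, mem_alternatingGroup.2 (by decide)⟩

/-- The double transposition `(0 1)(3 4)` in `A₅`. -/
def a5Invert : alternatingGroup (Fin 5) := ⟨swap 0 1 * swap 3 4, mem_alternatingGroup.2 (by decide)⟩

theorem isTetrahedral_a4 : IsTetrahedral a4Double a4Three := by
  constructor <;> decide

theorem isTetrahedral_a5 : IsTetrahedral a5Double a5Three := by
  constructor <;> decide

theorem s4_three_conj : a4Three.1 * swap 0 1 * a4Three.1 = swap 0 1 := by decide

theorem s4_double_comm : swap 0 1 * a4Double.1 = a4Double.1 * swap 0 1 := by decide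

theorem a5_three_conj : a5Three * a5Invert * a5Three = a5Invert := by decide

theorem a5_invert_double_cube :
    a5Invert * a5Double * (a5Invert * a5Double) * (a5Invert * a5Double) = 1 := by decide

/-- Conjugation by the odd permutation `(0 1)`, an outer automorphism of `A₅`. -/
def a5Outer : MulAut (alternatingGroup (Fin 5)) := MulAut.conjNormal (swap 0 1)

theorem a5Outer_double : a5Outer a5Double = a5Double := by decide

theorem a5Outer_three : a5Outer a5Three = a5Three⁻¹ := by decide

theorem a5Outer_invert : a5Outer a5Invert = a5Invert := by decide

theorem closure_a4 : Subgroup.closure {a4Double, a4Three} = ⊤ := by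
  rw [eq_top_iff]
  intro x _
  have h : ∃ a b : Fin 2, ∃ c : Fin 3, x = a4Double ^ (a : ℕ) *
      (a4Three * a4Double * a4Three⁻¹) ^ (b : ℕ) * a4Three ^ (c : ℕ) := by
    clear * -
    revert x
    decide
  obtain ⟨a, b, c, rfl⟩ := h
  have hv : a4Double ∈ Subgroup.closure {a4Double, a4Three} := Subgroup.subset_closure (by simp)
  have hg : a4Three ∈ Subgroup.closure {a4Double, a4Three} := Subgroup.subset_closure (by simp)
  exact mul_mem (mul_mem (pow_mem hv _) (pow_mem (mul_mem (mul_mem hg hv) (inv_mem hg)) _))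
    (pow_mem hg _)

theorem closure_s4 : Subgroup.closure {a4Double.1, a4Three.1, swap 0 1} = ⊤ := by
  have hA : alternatingGroup (Fin 4) ≤ Subgroup.closure {a4Double.1, a4Three.1, swap 0 1} := by
    have h := congrArg (Subgroup.map (alternatingGroup (Fin 4)).subtype) closure_a4
    rw [MonoidHom.map_closure, ← MonoidHom.range_eq_map, Subgroup.range_subtype] at h
    refine h.symm.le.trans (Subgroup.closure_mono ?_)
    rintro _ ⟨y, rfl | rfl, rfl⟩ <;> simp
  rw [eq_top_iff]
  intro x _
  have hs : swap 0 1 ∈ Subgroup.closure {a4Double.1, a4Three.1, swap 0 1} :=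
    Subgroup.subset_closure (by simp)
  rcases Int.units_eq_one_or (sign x) with hx | hx
  · exact hA (mem_alternatingGroup.2 hx)
  · have : x * swap 0 1 ∈ alternatingGroup (Fin 4) := by
      rw [mem_alternatingGroup, Perm.sign_mul, hx, sign_swap (by decide)]; rfl
    simpa using mul_mem (hA this) hs

set_option maxRecDepth 2000 in
theorem closure_a5 : Subgroup.closure {a5Double, a5Three, a5Invert} = ⊤ := by
  obtain ⟨K, hK⟩ : ∃ K, K = Subgroup.closure {a5Double, a5Three, a5Invert} := ⟨_, rfl⟩
  rw [← hK]
  have hv : a5Double ∈ K := hK ▸ Subgroup.subset_closure (by simp)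
  have hg : a5Three ∈ K := hK ▸ Subgroup.subset_closure (by simp)
  have ht : a5Invert ∈ K := hK ▸ Subgroup.subset_closure (by simp)
  have hdvd (p : ℕ) (hp : p.Prime) (x : alternatingGroup (Fin 5)) (hx : x ∈ K)
      (h1 : x ^ p = 1) (h0 : x ≠ 1) : p ∣ Nat.card K := by
    have := Fact.mk hp
    rw [← orderOf_eq_prime h1 h0, ← Subgroup.orderOf_mk x hx]
    exact orderOf_dvd_natCard _
  have d2 := hdvd 2 (by norm_num) _ hv (by decide) (by decide)
  have d3 := hdvd 3 (by norm_num) _ hg (by decide) (by decide)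
  have d5 := hdvd 5 (by norm_num) _ (mul_mem (mul_mem hg hv) ht) (by decide) (by decide)
  have hc : Nat.card (alternatingGroup (Fin 5)) = 60 := by
    rw [nat_card_alternatingGroup]; simp; decide
  have hm := K.card_mul_index
  rw [hc] at hm
  have h30 : 30 ∣ Nat.card K := by omega
  obtain ⟨m, hm'⟩ := h30
  have hmi : m * K.index = 2 := by
    rw [hm'] at hm; nlinarith
  have hi : K.index ∣ 2 := ⟨m, by rw [← hmi, mul_comm]⟩
  rcases (Nat.dvd_prime Nat.prime_two).1 hi with h | h
  · exact Subgroup.index_eq_one.1 h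
  · have hn := Subgroup.normal_of_index_eq_two h
    rcases hn.eq_bot_or_eq_top with h' | h'
    · rw [h', Subgroup.mem_bot] at hv
      exact absurd hv (by decide)
    · exact h'

end

/-- For a nondegenerate ternary quadratic form `q` of discriminant `1` over a field of
characteristic `≠ 2, 3, 5`, any two subgroups of `SO(q)(k)` both isomorphic to `A₄`, or
both isomorphic to `S₄`, or both isomorphic to `A₅`, are conjugate in `SO(q)(k)`. -/
theorem polyhedral_subgroups_conjugate
    (k : Type) [Field k] (h2 : ringChar k ≠ 2) (h3 : ringChar k ≠ 3) (h5 : ringChar k ≠ 5)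
    (Q : Matrix (Fin 3) (Fin 3) k) (hsymm : Qᵀ = Q)
    (hdisc : ∃ d : k, d ≠ 0 ∧ Q.det = d ^ 2)
    (H₁ H₂ : Subgroup (GL (Fin 3) k)) (hH₁ : H₁ ≤ SO3 k Q) (hH₂ : H₂ ≤ SO3 k Q)
    (hiso : (Nonempty (H₁ ≃* alternatingGroup (Fin 4)) ∧
              Nonempty (H₂ ≃* alternatingGroup (Fin 4))) ∨
            (Nonempty (H₁ ≃* Equiv.Perm (Fin 4)) ∧
              Nonempty (H₂ ≃* Equiv.Perm (Fin 4))) ∨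
            (Nonempty (H₁ ≃* alternatingGroup (Fin 5)) ∧
              Nonempty (H₂ ≃* alternatingGroup (Fin 5)))) :
    ∃ P ∈ SO3 k Q, ∀ x : GL (Fin 3) k, x ∈ H₂ ↔ P * x * P⁻¹ ∈ H₁ := by
  have h2' : (2 : k) ≠ 0 := Ring.two_ne_zero h2
  obtain ⟨d, hd0, hd⟩ := hdisc
  have hδ : d⁻¹ ≠ 0 := inv_ne_zero hd0
  have hdet : Q.det * d⁻¹ ^ 2 = 1 := by rw [hd]; field_simp
  have frame {G : Type} [Group G] {v g : G} (hvg : IsTetrahedral v g) {φ : G →* GL (Fin 3) k}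
      (hφ : Function.Injective φ) (hr : φ.range ≤ SO3 k Q) :
      ∃ E, IsFrame_s12 Q d⁻¹ (φ v) (φ g) E :=
    exists_isFrame_s12 h2' hsymm hδ hdet (hr ⟨v, rfl⟩) (hr ⟨g, rfl⟩) (hvg.map φ hφ)
  rcases hiso with ⟨i₁, i₂⟩ | ⟨i₁, i₂⟩ | ⟨i₁, i₂⟩ <;>
    obtain ⟨φ₁, hφ₁, rfl⟩ := exists_injective_range_eq i₁ <;>
    obtain ⟨φ₂, hφ₂, rfl⟩ := exists_injective_range_eq i₂
  · obtain ⟨E₁, hE₁⟩ := frame isTetrahedral_a4 hφ₁ hH₁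
    obtain ⟨E₂, hE₂⟩ := frame isTetrahedral_a4 hφ₂ hH₂
    refine ⟨_, hE₁.mul_inv_mem hE₂, mem_range_iff_conj_mem_range closure_a4 ?_⟩
    rintro _ (rfl | rfl)
    · exact conj_eq_of_mul_eq hE₁.half hE₂.half
    · exact conj_eq_of_mul_eq hE₁.cyclic hE₂.cyclic
  · have hvg := isTetrahedral_a4.map (alternatingGroup (Fin 4)).subtype
      (Subgroup.subtype_injective _)
    have turn {φ : Equiv.Perm (Fin 4) →* GL (Fin 3) k} (hr : φ.range ≤ SO3 k Q) {E}
        (hE : IsFrame_s12 Q d⁻¹ (φ a4Double.1) (φ a4Three.1) E) :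
        (φ (Equiv.swap 0 1)).1 * E.1 = E.1 * antiCirculant (-1) 0 0 := by
      refine hE.octahedral h2' (hr ⟨_, rfl⟩) ?_ ?_ <;> simp only [← map_mul]
      · rw [s4_three_conj]
      · rw [s4_double_comm]
    obtain ⟨E₁, hE₁⟩ := frame hvg hφ₁ hH₁
    obtain ⟨E₂, hE₂⟩ := frame hvg hφ₂ hH₂
    refine ⟨_, hE₁.mul_inv_mem hE₂, mem_range_iff_conj_mem_range closure_s4 ?_⟩
    rintro _ (rfl | rfl | rfl)
    · exact conj_eq_of_mul_eq hE₁.half hE₂.half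
    · exact conj_eq_of_mul_eq hE₁.cyclic hE₂.cyclic
    · exact conj_eq_of_mul_eq (turn hH₁ hE₁) (turn hH₂ hE₂)
  · have turn {φ : alternatingGroup (Fin 5) →* GL (Fin 3) k} (hr : φ.range ≤ SO3 k Q) {E}
        (hE : IsFrame_s12 Q d⁻¹ (φ a5Double) (φ a5Three) E) :
        ∃ b : k, (φ a5Invert).1 * E.1 = E.1 * antiCirculant (-1 / 2) b (-1 / 2 - b) ∧
          4 * b ^ 2 + 2 * b - 1 = 0 := by
      refine hE.icosahedral h2' (hr ⟨_, rfl⟩) ?_ ?_ <;> simp only [← map_mul]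
      · rw [a5_three_conj]
      · rw [a5_invert_double_cube, map_one]
    obtain ⟨E₁, hE₁⟩ := frame isTetrahedral_a5 hφ₁ hH₁
    obtain ⟨E₂, hE₂⟩ := frame isTetrahedral_a5 hφ₂ hH₂
    obtain ⟨b₁, hT₁, hb₁⟩ := turn hH₁ hE₁
    obtain ⟨b₂, hT₂, hb₂⟩ := turn hH₂ hE₂
    have hb : (b₁ - b₂) * (2 * (b₁ + b₂) + 1) = 0 :=
      (mul_eq_zero.1 (by linear_combination hb₁ - hb₂ :
        2 * ((b₁ - b₂) * (2 * (b₁ + b₂) + 1)) = 0)).resolve_left h2'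
    rcases mul_eq_zero.1 hb with hb | hb
    · obtain rfl : b₁ = b₂ := sub_eq_zero.1 hb
      refine ⟨_, hE₁.mul_inv_mem hE₂, mem_range_iff_conj_mem_range closure_a5 ?_⟩
      rintro _ (rfl | rfl | rfl)
      · exact conj_eq_of_mul_eq hE₁.half hE₂.half
      · exact conj_eq_of_mul_eq hE₁.cyclic hE₂.cyclic
      · exact conj_eq_of_mul_eq hT₁ hT₂
    · have hrange : φ₂.range = (φ₂.comp a5Outer.toMonoidHom).range := by
        rw [MonoidHom.range_comp, (MonoidHom.range_eq_top (f := a5Outer.toMonoidHom)).2 a5Outer.surjective,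
          ← MonoidHom.range_eq_map]
      have hF := hE₂.mul_swapTurn
      have hb' : -1 / 2 - b₂ = b₁ := by field_simp; linear_combination -hb
      have hb'' : b₂ = -1 / 2 - b₁ := by rw [← hb']; ring
      have hT : (φ₂ a5Invert).1 * (E₂ * swapTurn k).1 =
          (E₂ * swapTurn k).1 * antiCirculant (-1 / 2) b₁ (-1 / 2 - b₁) := by
        rw [Units.val_mul, ← mul_assoc, hT₂, mul_assoc, antiCirculant_mul_swapTurn, hb', hb'',
          mul_assoc]
      rw [hrange]
      refine ⟨_, hE₁.mul_inv_mem hF, mem_range_iff_conj_mem_range closure_a5 ?_⟩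
      rintro _ (rfl | rfl | rfl)
      · refine conj_eq_of_mul_eq hE₁.half ?_
        change (φ₂ (a5Outer a5Double)).1 * _ = _
        rw [a5Outer_double, hF.half]
      · refine conj_eq_of_mul_eq hE₁.cyclic ?_
        change (φ₂ (a5Outer a5Three)).1 * _ = _
        rw [a5Outer_three, map_inv, hF.cyclic]
      · refine conj_eq_of_mul_eq hT₁ ?_
        change (φ₂ (a5Outer a5Invert)).1 * _ = _
        rw [a5Outer_invert, hT]
end

section
/- Let k be a field with char(k) ≠ 2, let q be a nondegenerate ternary quadratic form over k with Gram matrix Q, and let M ∈ SO(q)(k) be a nontrivial unipotent matrix, i.e., M ≠ I₃ and (M − I₃) is nilpotent. Then q is isotropic: there exists a nonzero v ∈ k³ with vᵀ Q v = 0. -/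
open Matrix

/-- A nonzero nilpotent element `a` has a nonzero multiple `a * b` killed by `a`. -/
theorem IsNilpotent.exists_mul_ne_zero_mul_mul_eq_zero {R : Type*} [MonoidWithZero R] {a : R}
    (ha : IsNilpotent a) (h0 : a ≠ 0) : ∃ b, a * b ≠ 0 ∧ a * (a * b) = 0 := by
  by_contra! h
  obtain ⟨n, hn⟩ := ha
  have key : ∀ m : ℕ, a ^ (m + 1) ≠ 0 := by
    intro m
    induction m with
    | zero => simpa using h0
    | succ m ih =>
      rw [_root_.pow_succ'] at ih
      rw [_root_.pow_succ', _root_.pow_succ']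
      exact h _ ih
  exact key n (by rw [_root_.pow_succ, hn, zero_mul])

/-- If an isometry `M` of the bilinear form `Q` fixes the columns of `(M - 1) * S`,
then `Q` vanishes on the column space of that matrix. -/
theorem Matrix.transpose_mul_mul_eq_zero_of_isometry {n R : Type*} [Fintype n] [DecidableEq n]
    [CommRing R] {Q M S : Matrix n n R} (hMQ : Mᵀ * Q * M = Q)
    (hS : (M - 1) * ((M - 1) * S) = 0) :
    ((M - 1) * S)ᵀ * Q * ((M - 1) * S) = 0 := by
  generalize hP : (M - 1) * S = P at hS
  have hMP : M * P = P := by rwa [sub_mul, one_mul, sub_eq_zero] at hS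
  have hQP : Mᵀ * Q * P = Q * P := by
    conv_lhs => rw [← hMP, ← mul_assoc, hMQ]
  rw [← hP, transpose_mul, hP, transpose_sub, transpose_one, mul_assoc, mul_assoc, sub_mul,
    ← mul_assoc, hQP, one_mul, sub_self, mul_zero]

/-- If `SO(q)(k)` contains a nontrivial unipotent matrix, then the nondegenerate ternary
quadratic form `q` is isotropic. -/
theorem so3_unipotent_implies_isotropic
    (k : Type) [Field k] (hchar : ringChar k ≠ 2)
    (Q : Matrix (Fin 3) (Fin 3) k) (hsymm : Qᵀ = Q) (hnondeg : IsUnit Q.det)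
    (M : Matrix (Fin 3) (Fin 3) k)
    (hMQ : Mᵀ * Q * M = Q) (hMdet : M.det = 1)
    (hne : M ≠ 1) (hnil : IsNilpotent (M - 1)) :
    ∃ v : Fin 3 → k, v ≠ 0 ∧ v ⬝ᵥ Q.mulVec v = 0 := by
  obtain ⟨S, hS, hS'⟩ := hnil.exists_mul_ne_zero_mul_mul_eq_zero (sub_ne_zero.mpr hne)
  have h0 := transpose_mul_mul_eq_zero_of_isometry hMQ hS'
  generalize (M - 1) * S = P at hS h0
  obtain ⟨u, hu⟩ : ∃ u, P *ᵥ u ≠ 0 := by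
    by_contra! h
    exact hS (Matrix.ext_of_mulVec_single fun i => by rw [h, zero_mulVec])
  refine ⟨P *ᵥ u, hu, ?_⟩
  rw [← vecMul_transpose, ← dotProduct_mulVec, vecMul_transpose, mulVec_mulVec, mulVec_mulVec,
    h0, zero_mulVec, dotProduct_zero]
end

section
/- Let k be a field with char(k) ≠ 2 and let n ≥ 3 be odd. Suppose there exist a primitive n-th root of unity ω in an algebraic closure k̄ of k and α ∈ k whose image in k̄ equals (ω + ω⁻¹)/2. Then (α + 1)/2 is a square in k: there exists x ∈ k with x² = (α + 1)/2. (Indeed, (α+1)/2 = (1/4)(ω^((n+1)/2) + ω^(−(n+1)/2))², and ω^((n+1)/2) + ω^(−(n+1)/2) lies in k since it is an integer polynomial in ω + ω⁻¹.) -/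
open Matrix

/-- Let `n ≥ 3` be odd, let `ω` be a primitive `n`-th root of unity in an algebraic closure
of `k`, and let `α ∈ k` be an element whose image in the algebraic closure is
`(ω + ω⁻¹)/2`.  Then `(α + 1)/2` is a square in `k`. -/
theorem alpha_plus_one_half_is_square_of_odd
    (k : Type) [Field k] (hchar : ringChar k ≠ 2)
    (n : ℕ) (hn : 3 ≤ n) (hodd : Odd n)
    (ω : AlgebraicClosure k) (hω : IsPrimitiveRoot ω n)
    (α : k) (hα : algebraMap k (AlgebraicClosure k) α = (ω + ω⁻¹) / 2) :
    ∃ x : k, x ^ 2 = (α + 1) / 2 := by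
  obtain ⟨m, rfl⟩ := hodd
  have h2 : (2 : k) ≠ 0 := Ring.two_ne_zero hchar
  have h2' : (2 : AlgebraicClosure k) ≠ 0 := by
    rw [← map_ofNat (algebraMap k (AlgebraicClosure k)) 2]
    exact (map_ne_zero _).2 h2
  have hinv : ω * ω⁻¹ = 1 := mul_inv_cancel₀ (hω.ne_zero (by omega))
  have hsum : algebraMap k (AlgebraicClosure k) (2 * α) = ω + ω⁻¹ := by
    rw [map_mul, hα, map_ofNat]
    field_simp
  set d : k := (Polynomial.dickson 1 (1 : k) (m + 1)).eval (2 * α) with hd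
  have hd_map : algebraMap k (AlgebraicClosure k) d = ω ^ (m + 1) + ω⁻¹ ^ (m + 1) := by
    rw [hd, ← Polynomial.eval_map_apply, Polynomial.map_dickson, map_one, hsum,
      Polynomial.dickson_one_one_eval_add_inv _ _ hinv]
  have hd_sq : d ^ 2 = 2 * α + 2 := by
    apply (algebraMap k (AlgebraicClosure k)).injective
    have hpow : ω ^ (2 * m + 1) = 1 := hω.pow_eq_one
    have hpow_inv : ω⁻¹ ^ (2 * m + 1) = 1 := by rw [inv_pow, hpow, inv_one]
    have hprod : ω ^ (m + 1) * ω⁻¹ ^ (m + 1) = 1 := by rw [← mul_pow, hinv, one_pow]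
    rw [map_pow, hd_map, map_add, hsum, map_ofNat]
    linear_combination ω * hpow + ω⁻¹ * hpow_inv + 2 * hprod
  refine ⟨d / 2, ?_⟩
  rw [div_pow, hd_sq]
  field_simp
end
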